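/- arXiv:1706.03989 — 6 statements merged into one kernel-verified Lean document; each statement's English description precedes it below -/
import Mathlib

section
/- Let f : ℝ → ℂ be a locally integrable function such that ∫_ℝ |f(x)|/(x²+1) dx < ∞, and define F(z) = (1/(2πi)) ∫_ℝ f(x) (1/(x−z) − 1/(x−i)) dx for z ∈ ℂ \ ℝ. Then F is holomorphic on ℂ \ ℝ, and for every continuous compactly supported function g : ℝ → ℂ one has lim_{y→0+} ∫_ℝ (F(x+iy) − F(x−iy)) g(x) dx = ∫_ℝ f(x) g(x) dx; that is, the hyperfunction boundary value of F is f. -/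
open MeasureTheory Complex Filter Topology

lemma sq_add_one_le_mul_norm_sub_sq {ε R : ℝ} (hε : 0 < ε) {z : ℂ} (hz : ε ≤ |z.im|)
    (hR : ‖z‖ ≤ R) (x : ℝ) :
    x ^ 2 + 1 ≤ (2 + (2 * R ^ 2 + 1) / ε ^ 2) * ‖(x : ℂ) - z‖ ^ 2 := by
  have h_im : ε ≤ ‖(x : ℂ) - z‖ := by
    refine hz.trans ?_
    simpa using abs_im_le_norm ((x : ℂ) - z)
  have h_tri : |x| ≤ ‖(x : ℂ) - z‖ + R := by
    have := norm_le_norm_sub_add (x : ℂ) z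
    rw [norm_real, Real.norm_eq_abs] at this
    linarith
  have h_x : x ^ 2 ≤ 2 * ‖(x : ℂ) - z‖ ^ 2 + 2 * R ^ 2 := by
    have := pow_le_pow_left₀ (abs_nonneg x) h_tri 2
    rw [sq_abs] at this
    nlinarith [sq_nonneg (‖(x : ℂ) - z‖ - R)]
  have h_one : 1 ≤ ‖(x : ℂ) - z‖ ^ 2 / ε ^ 2 := by
    rw [one_le_div (by positivity)]
    gcongr
  have h_mul := mul_le_mul_of_nonneg_left h_one (by positivity : 0 ≤ 2 * R ^ 2 + 1)
  calc x ^ 2 + 1 ≤ 2 * ‖(x : ℂ) - z‖ ^ 2 + (2 * R ^ 2 + 1) * (‖(x : ℂ) - z‖ ^ 2 / ε ^ 2) := by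
        linarith
    _ = _ := by ring

lemma norm_one_div_sub_sq_le {ε R : ℝ} (hε : 0 < ε) {z : ℂ} (hz : ε ≤ |z.im|)
    (hR : ‖z‖ ≤ R) (x : ℝ) :
    ‖1 / ((x : ℂ) - z) ^ 2‖ ≤ (2 + (2 * R ^ 2 + 1) / ε ^ 2) / (x ^ 2 + 1) := by
  have h := sq_add_one_le_mul_norm_sub_sq hε hz hR x
  have h0 : 0 < ‖(x : ℂ) - z‖ ^ 2 := by
    by_contra! h'
    have : ‖(x : ℂ) - z‖ ^ 2 = 0 := le_antisymm h' (by positivity)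
    rw [this] at h
    nlinarith [sq_nonneg x]
  rw [norm_div, norm_one, norm_pow, div_le_div_iff₀ h0 (by positivity)]
  linarith

lemma ofReal_sub_ne_zero {z : ℂ} (hz : z.im ≠ 0) (x : ℝ) : (x : ℂ) - z ≠ 0 := by
  intro h
  apply hz
  simpa using congrArg Complex.im h

lemma integrable_mul_of_norm_le_div {f k : ℝ → ℂ} (hf : AEStronglyMeasurable f volume)
    (hint : Integrable (fun x : ℝ => ‖f x‖ / (x ^ 2 + 1)) volume)
    (hk : Continuous k) {C : ℝ} (hC : ∀ x, ‖k x‖ ≤ C / (x ^ 2 + 1)) :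
    Integrable (fun x => f x * k x) := by
  refine (hint.const_mul C).mono' (hf.mul hk.aestronglyMeasurable) (ae_of_all _ fun x => ?_)
  rw [norm_mul]
  calc ‖f x‖ * ‖k x‖ ≤ ‖f x‖ * (C / (x ^ 2 + 1)) := by gcongr; exact hC x
    _ = _ := by ring

lemma continuous_cauchy_kernel {z : ℂ} (hz : z.im ≠ 0) :
    Continuous fun x : ℝ => 1 / ((x : ℂ) - z) - 1 / ((x : ℂ) - I) := by
  have h1 := ofReal_sub_ne_zero hz
  have h2 := ofReal_sub_ne_zero (z := I) (by simp)
  fun_prop (disch := assumption)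

lemma integrable_cauchy_kernel {f : ℝ → ℂ} (hf : AEStronglyMeasurable f volume)
    (hint : Integrable (fun x : ℝ => ‖f x‖ / (x ^ 2 + 1)) volume) {z : ℂ} (hz : z.im ≠ 0) :
    Integrable fun x : ℝ => f x * (1 / ((x : ℂ) - z) - 1 / ((x : ℂ) - I)) := by
  refine integrable_mul_of_norm_le_div hf hint (continuous_cauchy_kernel hz)
    (C := ‖z - I‖ * ((2 + (2 * ‖z‖ ^ 2 + 1) / |z.im| ^ 2) + (2 + (2 * 1 ^ 2 + 1) / 1 ^ 2)))
    fun x => ?_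
  have h1 := norm_one_div_sub_sq_le (abs_pos.2 hz) le_rfl le_rfl x
  have h2 := norm_one_div_sub_sq_le (z := I) one_pos (R := 1) (by simp) (by simp) x
  have h : 1 / ((x : ℂ) - z) - 1 / ((x : ℂ) - I)
      = (z - I) * ((1 / ((x : ℂ) - z)) * (1 / ((x : ℂ) - I))) := by
    have := ofReal_sub_ne_zero hz x
    have := ofReal_sub_ne_zero (z := I) (by simp) x
    field_simp
    ring
  rw [← one_div_pow, norm_pow] at h1 h2
  rw [h, norm_mul, norm_mul, mul_div_assoc, add_div]
  gcongr
  nlinarith [sq_nonneg (‖1 / ((x : ℂ) - z)‖ - ‖1 / ((x : ℂ) - I)‖),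
    norm_nonneg (1 / ((x : ℂ) - z)), norm_nonneg (1 / ((x : ℂ) - I)),
    sq_nonneg ‖1 / ((x : ℂ) - z)‖, sq_nonneg ‖1 / ((x : ℂ) - I)‖]

lemma differentiableAt_cauchy_integral {f : ℝ → ℂ} (hf : AEStronglyMeasurable f volume)
    (hint : Integrable (fun x : ℝ => ‖f x‖ / (x ^ 2 + 1)) volume) {z : ℂ} (hz : z.im ≠ 0) :
    DifferentiableAt ℂ
      (fun w : ℂ => ∫ x : ℝ, f x * (1 / ((x : ℂ) - w) - 1 / ((x : ℂ) - I))) z := by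
  set ε := |z.im| / 2 with hε_def
  have hε : 0 < ε := by have := abs_pos.2 hz; positivity
  have h_im : ∀ w ∈ Metric.ball z ε, ε ≤ |w.im| := by
    intro w hw
    rw [Metric.mem_ball, dist_comm, dist_eq_norm] at hw
    have h1 := abs_im_le_norm (z - w)
    rw [sub_im] at h1
    have h2 := abs_sub_abs_le_abs_sub z.im w.im
    linarith
  have h_norm : ∀ w ∈ Metric.ball z ε, ‖w‖ ≤ ‖z‖ + ε := by
    intro w hw
    rw [Metric.mem_ball, dist_eq_norm] at hw
    have := norm_le_norm_sub_add w z
    linarith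
  have h_ne : ∀ w ∈ Metric.ball z ε, w.im ≠ 0 := fun w hw =>
    abs_pos.1 (hε.trans_le (h_im w hw))
  have h_nhds := Metric.ball_mem_nhds z hε
  refine (hasDerivAt_integral_of_dominated_loc_of_deriv_le
    (F' := fun w x => f x * (1 / ((x : ℂ) - w) ^ 2))
    (bound := fun x => (2 + (2 * (‖z‖ + ε) ^ 2 + 1) / ε ^ 2) * (‖f x‖ / (x ^ 2 + 1)))
    h_nhds ?_ (integrable_cauchy_kernel hf hint hz) ?_ ?_ (hint.const_mul _)
    ?_).2.differentiableAt
  · filter_upwards [h_nhds] with w hw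
    exact hf.mul (continuous_cauchy_kernel (h_ne w hw)).aestronglyMeasurable
  · refine hf.mul (Continuous.aestronglyMeasurable ?_)
    have : ∀ x : ℝ, ((x : ℂ) - z) ^ 2 ≠ 0 := fun x => pow_ne_zero 2 (ofReal_sub_ne_zero hz x)
    fun_prop (disch := assumption)
  · refine ae_of_all _ fun x w hw => ?_
    rw [norm_mul]
    calc ‖f x‖ * ‖1 / ((x : ℂ) - w) ^ 2‖
        ≤ ‖f x‖ * ((2 + (2 * (‖z‖ + ε) ^ 2 + 1) / ε ^ 2) / (x ^ 2 + 1)) := by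
          gcongr
          exact norm_one_div_sub_sq_le hε (h_im w hw) (h_norm w hw) x
      _ = _ := by ring
  · refine ae_of_all _ fun x w hw => ?_
    have h := ofReal_sub_ne_zero (h_ne w hw) x
    simp only [one_div]
    exact (((((hasDerivAt_id' w).const_sub (x : ℂ)).fun_inv h).sub_const _).const_mul
      (f x)).congr_deriv (by simp)

/-- `π` times the Poisson kernel of the upper half-plane. -/
noncomputable def poissonKer (y s : ℝ) : ℝ := y / (s ^ 2 + y ^ 2)

lemma continuous_poissonKer {y : ℝ} (hy : 0 < y) : Continuous (poissonKer y) := by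
  have : ∀ s : ℝ, s ^ 2 + y ^ 2 ≠ 0 := fun s => by positivity
  unfold poissonKer
  fun_prop (disch := assumption)

lemma poissonKer_nonneg {y : ℝ} (hy : 0 < y) (s : ℝ) : 0 ≤ poissonKer y s := by
  unfold poissonKer; positivity

lemma cauchy_kernel_jump {y : ℝ} (hy : 0 < y) (x t : ℝ) :
    (1 / ((t : ℂ) - (x + y * I)) - 1 / ((t : ℂ) - I))
      - (1 / ((t : ℂ) - (x - y * I)) - 1 / ((t : ℂ) - I))
      = 2 * I * (poissonKer y (t - x) : ℂ) := by
  have h1 := ofReal_sub_ne_zero (z := x + y * I) (by simp [hy.ne']) t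
  have h2 := ofReal_sub_ne_zero (z := x - y * I) (by simp [hy.ne']) t
  have h3 : ((t : ℂ) - x) ^ 2 + y ^ 2
      = ((t : ℂ) - (x + y * I)) * ((t : ℂ) - (x - y * I)) := by
    linear_combination (y : ℂ) ^ 2 * I_sq
  rw [poissonKer]
  push_cast
  rw [h3]
  field_simp
  ring

lemma cauchy_integral_jump {f : ℝ → ℂ} (hf : AEStronglyMeasurable f volume)
    (hint : Integrable (fun x : ℝ => ‖f x‖ / (x ^ 2 + 1)) volume) {y : ℝ} (hy : 0 < y) (x : ℝ) :
    1 / (2 * Real.pi * I) *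
        (∫ t : ℝ, f t * (1 / ((t : ℂ) - (x + y * I)) - 1 / ((t : ℂ) - I)))
      - 1 / (2 * Real.pi * I) *
        (∫ t : ℝ, f t * (1 / ((t : ℂ) - (x - y * I)) - 1 / ((t : ℂ) - I)))
      = 1 / Real.pi * ∫ t : ℝ, f t * (poissonKer y (t - x) : ℂ) := by
  rw [← mul_sub, ← integral_sub (integrable_cauchy_kernel hf hint (by simp [hy.ne']))
    (integrable_cauchy_kernel hf hint (by simp [hy.ne']))]
  simp_rw [← mul_sub, cauchy_kernel_jump hy, mul_left_comm (f _) (2 * I)]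
  rw [integral_const_mul, ← mul_assoc]
  congr 1
  have := Real.pi_ne_zero
  field_simp

lemma sq_add_one_mul_poissonKer_le {y : ℝ} (hy : 0 < y) (t x : ℝ) :
    (t ^ 2 + 1) * poissonKer y (t - x) ≤ 2 * y + (2 * x ^ 2 + 1) / y := by
  have h1 : (t - x) ^ 2 * poissonKer y (t - x) ≤ y := by
    rw [poissonKer, mul_div_assoc', div_le_iff₀ (by positivity)]
    nlinarith [mul_pos (mul_pos hy hy) hy]
  have h2 : poissonKer y (t - x) ≤ 1 / y := by
    rw [poissonKer, div_le_div_iff₀ (by positivity) hy]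
    nlinarith [sq_nonneg (t - x)]
  have h3 : (t ^ 2 + 1) * poissonKer y (t - x)
      ≤ (2 * (t - x) ^ 2 + (2 * x ^ 2 + 1)) * poissonKer y (t - x) := by
    refine mul_le_mul_of_nonneg_right ?_ (poissonKer_nonneg hy _)
    nlinarith [sq_nonneg (t - 2 * x)]
  have h4 : (2 * x ^ 2 + 1) * poissonKer y (t - x) ≤ (2 * x ^ 2 + 1) * (1 / y) := by gcongr
  rw [mul_one_div] at h4
  linarith

lemma integrable_poisson_prod {f g : ℝ → ℂ} (hf : AEStronglyMeasurable f volume)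
    (hint : Integrable (fun x : ℝ => ‖f x‖ / (x ^ 2 + 1)) volume)
    (hg : Continuous g) (hgc : HasCompactSupport g) {y : ℝ} (hy : 0 < y) :
    Integrable (fun p : ℝ × ℝ => f p.2 * (poissonKer y (p.2 - p.1) : ℂ) * g p.1)
      (volume.prod volume) := by
  have hh : Integrable fun x : ℝ => (2 * y + (2 * x ^ 2 + 1) / y) * ‖g x‖ :=
    Continuous.integrable_of_hasCompactSupport (by fun_prop) hgc.norm.mul_left
  refine (hh.mul_prod hint).mono' ?_ (ae_of_all _ fun p => ?_)
  · have hk := continuous_poissonKer hy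
    exact (hf.comp_snd.mul (Continuous.aestronglyMeasurable (by fun_prop))).mul
      (Continuous.aestronglyMeasurable (by fun_prop))
  · rw [norm_mul, norm_mul, norm_real, Real.norm_of_nonneg (poissonKer_nonneg hy _)]
    have h := sq_add_one_mul_poissonKer_le hy p.2 p.1
    have h0 : 0 < p.2 ^ 2 + 1 := by positivity
    calc ‖f p.2‖ * poissonKer y (p.2 - p.1) * ‖g p.1‖
        = ((p.2 ^ 2 + 1) * poissonKer y (p.2 - p.1)) * ‖g p.1‖ * (‖f p.2‖ / (p.2 ^ 2 + 1)) := by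
          field_simp
      _ ≤ _ := by gcongr

lemma integral_poissonKer_mul (g : ℝ → ℂ) {y : ℝ} (hy : 0 < y) (t : ℝ) :
    ∫ x : ℝ, (poissonKer y (t - x) : ℂ) * g x
      = ∫ u : ℝ, (((1 + u ^ 2)⁻¹ : ℝ) : ℂ) * g (t + y * u) := by
  rw [← integral_add_left_eq_self _ t]
  have h := Measure.integral_comp_mul_left
    (fun s : ℝ => (poissonKer y (t - (t + s)) : ℂ) * g (t + s)) y
  rw [abs_of_pos (inv_pos.2 hy), eq_inv_smul_iff₀ hy.ne'] at h
  rw [← h, ← integral_smul]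
  refine integral_congr_ae (ae_of_all _ fun u => ?_)
  have hk : (1 + u ^ 2)⁻¹ = y * poissonKer y (t - (t + y * u)) := by
    rw [poissonKer]
    have : (1 + u ^ 2) ≠ 0 := by positivity
    have : (t - (t + y * u)) ^ 2 + y ^ 2 = y ^ 2 * (1 + u ^ 2) := by ring
    rw [this]
    field_simp
  simp only [hk, real_smul]
  push_cast
  ring

lemma tendsto_poisson_average {g : ℝ → ℂ} (hg : Continuous g) (hgc : HasCompactSupport g)
    (t : ℝ) :
    Tendsto (fun y : ℝ => ∫ u : ℝ, (((1 + u ^ 2)⁻¹ : ℝ) : ℂ) * g (t + y * u)) (𝓝[>] 0)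
      (𝓝 (Real.pi * g t)) := by
  obtain ⟨M, hM⟩ := hgc.exists_bound_of_continuous hg
  have hlim : ∫ u : ℝ, (((1 + u ^ 2)⁻¹ : ℝ) : ℂ) * g t = Real.pi * g t := by
    rw [integral_mul_const, integral_complex_ofReal, integral_univ_inv_one_add_sq]
  have hne : ∀ u : ℝ, 1 + u ^ 2 ≠ 0 := fun u => by positivity
  rw [← hlim]
  refine tendsto_integral_filter_of_dominated_convergence (fun u => (1 + u ^ 2)⁻¹ * M)
    (Eventually.of_forall fun y => Continuous.aestronglyMeasurable ?_)
    (Eventually.of_forall fun y => ae_of_all _ fun u => ?_)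
    (integrable_inv_one_add_sq.mul_const M) (ae_of_all _ fun u => ?_)
  · fun_prop (disch := assumption)
  · rw [norm_mul, norm_real, Real.norm_of_nonneg (by positivity)]
    gcongr
    exact hM _
  · refine Tendsto.mono_left ?_ nhdsWithin_le_nhds
    have : Continuous fun y : ℝ => (((1 + u ^ 2)⁻¹ : ℝ) : ℂ) * g (t + y * u) := by fun_prop
    simpa using this.tendsto 0

lemma exists_poisson_average_bound {g : ℝ → ℂ} (hg : Continuous g) (hgc : HasCompactSupport g) :
    ∃ C : ℝ, ∀ y : ℝ, 0 < y → y ≤ 1 → ∀ t : ℝ,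
      ‖∫ u : ℝ, (((1 + u ^ 2)⁻¹ : ℝ) : ℂ) * g (t + y * u)‖ ≤ C / (t ^ 2 + 1) := by
  have hc : HasCompactSupport fun x : ℝ => (2 * x ^ 2 + 1) * ‖g x‖ := hgc.norm.mul_left
  obtain ⟨M, hM⟩ := hc.exists_bound_of_continuous (by fun_prop)
  have hgi : Integrable fun x => ‖g x‖ := (hg.integrable_of_hasCompactSupport hgc).norm
  refine ⟨Real.pi * M + 2 * ∫ x, ‖g x‖, fun y hy hy1 t => ?_⟩
  have hgi' : Integrable fun u => ‖g (t + y * u)‖ :=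
    Integrable.comp_mul_left' (g := fun s => ‖g (t + s)‖) (hgi.comp_add_left t) hy.ne'
  have hgint : ∫ u, ‖g (t + y * u)‖ = y⁻¹ * ∫ x, ‖g x‖ := by
    rw [Measure.integral_comp_mul_left (fun s => ‖g (t + s)‖) y,
      integral_add_left_eq_self (fun s => ‖g s‖) t, abs_of_pos (inv_pos.2 hy), smul_eq_mul]
  have hbound : ∀ u : ℝ, (t ^ 2 + 1) * ‖(((1 + u ^ 2)⁻¹ : ℝ) : ℂ) * g (t + y * u)‖
      ≤ (1 + u ^ 2)⁻¹ * M + 2 * y ^ 2 * ‖g (t + y * u)‖ := by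
    intro u
    rw [norm_mul, norm_real, Real.norm_of_nonneg (by positivity)]
    have h1 := (le_abs_self _).trans (hM (t + y * u))
    have h2 : t ^ 2 + 1 ≤ (2 * (t + y * u) ^ 2 + 1) + 2 * y ^ 2 * (1 + u ^ 2) := by
      nlinarith [sq_nonneg (t + 2 * y * u), sq_nonneg y]
    have h3 : (1 + u ^ 2) ≠ 0 := by positivity
    calc (t ^ 2 + 1) * ((1 + u ^ 2)⁻¹ * ‖g (t + y * u)‖)
        ≤ ((2 * (t + y * u) ^ 2 + 1) + 2 * y ^ 2 * (1 + u ^ 2))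
            * ((1 + u ^ 2)⁻¹ * ‖g (t + y * u)‖) := by gcongr
      _ = (1 + u ^ 2)⁻¹ * ((2 * (t + y * u) ^ 2 + 1) * ‖g (t + y * u)‖)
            + 2 * y ^ 2 * ‖g (t + y * u)‖ := by field_simp
      _ ≤ _ := by gcongr
  rw [le_div_iff₀ (by positivity), mul_comm]
  calc (t ^ 2 + 1) * ‖∫ u : ℝ, (((1 + u ^ 2)⁻¹ : ℝ) : ℂ) * g (t + y * u)‖
      ≤ (t ^ 2 + 1) * ∫ u : ℝ, ‖(((1 + u ^ 2)⁻¹ : ℝ) : ℂ) * g (t + y * u)‖ := by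
        gcongr
        exact norm_integral_le_integral_norm _
    _ = ∫ u : ℝ, (t ^ 2 + 1) * ‖(((1 + u ^ 2)⁻¹ : ℝ) : ℂ) * g (t + y * u)‖ :=
        (integral_const_mul _ _).symm
    _ ≤ ∫ u : ℝ, ((1 + u ^ 2)⁻¹ * M + 2 * y ^ 2 * ‖g (t + y * u)‖) :=
        integral_mono_of_nonneg (ae_of_all _ fun u => by positivity)
          ((integrable_inv_one_add_sq.mul_const M).add (hgi'.const_mul _))
          (ae_of_all _ hbound)
    _ = Real.pi * M + 2 * y * ∫ x, ‖g x‖ := by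
        rw [integral_add (integrable_inv_one_add_sq.mul_const M) (hgi'.const_mul _),
          integral_mul_const, integral_univ_inv_one_add_sq, integral_const_mul, hgint]
        field_simp
    _ ≤ Real.pi * M + 2 * ∫ x, ‖g x‖ := by
        have : 0 ≤ ∫ x, ‖g x‖ := integral_nonneg fun x => norm_nonneg _
        nlinarith

lemma tendsto_integral_mul_poisson_average {f g : ℝ → ℂ} (hf : AEStronglyMeasurable f volume)
    (hint : Integrable (fun x : ℝ => ‖f x‖ / (x ^ 2 + 1)) volume)
    (hg : Continuous g) (hgc : HasCompactSupport g) :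
    Tendsto (fun y : ℝ => ∫ t : ℝ, f t * ∫ u : ℝ, (((1 + u ^ 2)⁻¹ : ℝ) : ℂ) * g (t + y * u))
      (𝓝[>] 0) (𝓝 (∫ t : ℝ, f t * (Real.pi * g t))) := by
  obtain ⟨C, hC⟩ := exists_poisson_average_bound hg hgc
  have hne : ∀ u : ℝ, 1 + u ^ 2 ≠ 0 := fun u => by positivity
  refine tendsto_integral_filter_of_dominated_convergence
    (fun t => C * (‖f t‖ / (t ^ 2 + 1)))
    (Eventually.of_forall fun y => hf.mul ?_) ?_ (hint.const_mul C)
    (ae_of_all _ fun t => (tendsto_poisson_average hg hgc t).const_mul (f t))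
  · have h : Continuous fun p : ℝ × ℝ =>
        (((1 + p.2 ^ 2)⁻¹ : ℝ) : ℂ) * g (p.1 + y * p.2) := by
      have : ∀ p : ℝ × ℝ, 1 + p.2 ^ 2 ≠ 0 := fun p => hne p.2
      fun_prop (disch := assumption)
    exact h.stronglyMeasurable.integral_prod_right.aestronglyMeasurable
  · filter_upwards [Ioc_mem_nhdsGT one_pos] with y hy
    refine ae_of_all _ fun t => ?_
    rw [norm_mul]
    calc _ ≤ ‖f t‖ * (C / (t ^ 2 + 1)) := by gcongr; exact hC y hy.1 hy.2 t
      _ = _ := by ring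

theorem stmt_0 (f : ℝ → ℂ)
    (hloc : LocallyIntegrable f volume)
    (hint : Integrable (fun x : ℝ => ‖f x‖ / (x ^ 2 + 1)) volume)
    (F : ℂ → ℂ)
    (hF : ∀ z : ℂ, z.im ≠ 0 →
      F z = (1 / (2 * Real.pi * I)) *
        ∫ x : ℝ, f x * (1 / ((x : ℂ) - z) - 1 / ((x : ℂ) - I))) :
    DifferentiableOn ℂ F {z : ℂ | z.im ≠ 0} ∧
    ∀ g : ℝ → ℂ, Continuous g → HasCompactSupport g →
      Tendsto
        (fun y : ℝ =>
          ∫ x : ℝ, (F ((x : ℂ) + (y : ℂ) * I) - F ((x : ℂ) - (y : ℂ) * I)) * g x)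
        (𝓝[>] 0)
        (𝓝 (∫ x : ℝ, f x * g x)) := by
  have hf := hloc.aestronglyMeasurable
  refine ⟨?_, fun g hg hgc => ?_⟩
  · refine DifferentiableOn.congr (fun z hz => ?_) hF
    exact ((differentiableAt_cauchy_integral hf hint hz).const_mul _).differentiableWithinAt
  · have hlim := (tendsto_integral_mul_poisson_average hf hint hg hgc).const_mul
      (1 / Real.pi : ℂ)
    have hval : (1 / Real.pi : ℂ) * ∫ t : ℝ, f t * (Real.pi * g t) = ∫ x : ℝ, f x * g x := by
      rw [← integral_const_mul]
      congr with t
      have := Real.pi_ne_zero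
      field_simp
    rw [hval] at hlim
    refine hlim.congr' ?_
    filter_upwards [self_mem_nhdsWithin] with y (hy : 0 < y)
    have hprod := integrable_poisson_prod hf hint hg hgc hy
    calc _ = (1 / Real.pi : ℂ) * ∫ t : ℝ, ∫ x : ℝ, f t * (poissonKer y (t - x) : ℂ) * g x := by
          simp_rw [← integral_poissonKer_mul g hy, ← integral_const_mul, mul_assoc]
      _ = (1 / Real.pi : ℂ) * ∫ x : ℝ, ∫ t : ℝ, f t * (poissonKer y (t - x) : ℂ) * g x := by
          congr 1
          exact (integral_integral_swap
            (f := fun x t : ℝ => f t * (poissonKer y (t - x) : ℂ) * g x) hprod).symm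
      _ = _ := by
          rw [← integral_const_mul]
          congr with x
          rw [hF _ (by simp [hy.ne']), hF _ (by simp [hy.ne']), cauchy_integral_jump hf hint hy,
            integral_mul_const, mul_assoc]
end

section
/- Let μ be a probability measure on ℝ with characteristic function φ(t) = ∫_ℝ exp(itx) dμ(x). Then for every w ∈ ℂ \ ℝ, the estimate |(1/(2πi)) ∫_{−∞}^{∞} φ(t) (1/(t−w) − 1/(t−i)) dt| ≤ (|w−i|/π) · (1 + (|Re w| + 1)/|Im w|) holds. In particular, the defining function of the hyperfunction corresponding to φ is slowly increasing: for every compact set K ⊂ ℝ \ {0} and every ε > 0 there is C > 0 with |F(w)| ≤ C e^{ε|Re w|} for all w with Im w ∈ K, where F(w) = (1/(2πi)) ∫_ℝ φ(t)(1/(t−w) − 1/(t−i)) dt. -/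
open MeasureTheory Complex Filter Topology

lemma inv_sub_sq_add_sq_eq (x t : ℝ) {y : ℝ} (hy : y ≠ 0) :
    ((t - x) ^ 2 + y ^ 2)⁻¹ = (y ^ 2)⁻¹ * (1 + ((t - x) / y) ^ 2)⁻¹ := by
  rw [← mul_inv]
  congr 1
  field_simp
  ring

lemma integrable_inv_sub_sq_add_sq (x : ℝ) {y : ℝ} (hy : y ≠ 0) :
    Integrable fun t : ℝ => ((t - x) ^ 2 + y ^ 2)⁻¹ := by
  simp_rw [fun t => inv_sub_sq_add_sq_eq x t hy]
  exact ((integrable_inv_one_add_sq.comp_div hy).comp_sub_right x).const_mul _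

lemma integral_inv_sub_sq_add_sq (x : ℝ) {y : ℝ} (hy : y ≠ 0) :
    ∫ t : ℝ, ((t - x) ^ 2 + y ^ 2)⁻¹ = Real.pi / |y| := by
  simp_rw [fun t => inv_sub_sq_add_sq_eq x t hy]
  rw [integral_const_mul, integral_sub_right_eq_self (fun t : ℝ => (1 + (t / y) ^ 2)⁻¹) x,
    Measure.integral_comp_div (fun t : ℝ => (1 + t ^ 2)⁻¹) y, integral_univ_inv_one_add_sq,
    ← sq_abs y, smul_eq_mul]
  have : |y| ≠ 0 := abs_ne_zero.mpr hy
  field_simp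

lemma norm_ofReal_sub_sq (t : ℝ) (w : ℂ) : ‖(t : ℂ) - w‖ ^ 2 = (t - w.re) ^ 2 + w.im ^ 2 := by
  rw [Complex.sq_norm, Complex.normSq_apply]
  simp
  ring

lemma norm_one_div_sub_one_div_le (t : ℝ) {w z : ℂ} (hw : w.im ≠ 0) (hz : z.im ≠ 0) :
    ‖1 / ((t : ℂ) - w) - 1 / ((t : ℂ) - z)‖ ≤
      ‖w - z‖ * (((t - w.re) ^ 2 + w.im ^ 2)⁻¹ + ((t - z.re) ^ 2 + z.im ^ 2)⁻¹) / 2 := by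
  have ne : ∀ {v : ℂ}, v.im ≠ 0 → (t : ℂ) - v ≠ 0 := fun hv h => hv <| by
    simpa using congrArg Complex.im h
  rw [div_sub_div _ _ (ne hw) (ne hz), ← norm_ofReal_sub_sq, ← norm_ofReal_sub_sq, norm_div,
    norm_mul, show 1 * ((t : ℂ) - z) - ((t : ℂ) - w) * 1 = w - z by ring, div_eq_mul_inv,
    mul_div_assoc, mul_inv]
  gcongr
  rw [← inv_pow, ← inv_pow]
  linarith [two_mul_le_add_sq ‖(t : ℂ) - w‖⁻¹ ‖(t : ℂ) - z‖⁻¹]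

lemma norm_integral_mul_one_div_sub_le {φ : ℝ → ℂ} (hφ : ∀ t, ‖φ t‖ ≤ 1) {w : ℂ}
    (hw : w.im ≠ 0) :
    ‖∫ t : ℝ, φ t * (1 / ((t : ℂ) - w) - 1 / ((t : ℂ) - I))‖ ≤
      ‖w - I‖ * (Real.pi / |w.im| + Real.pi) / 2 := by
  have hI : I.im ≠ 0 := by simp
  have h := norm_integral_le_of_norm_le
    (f := fun t : ℝ => φ t * (1 / ((t : ℂ) - w) - 1 / ((t : ℂ) - I)))
    ((((integrable_inv_sub_sq_add_sq w.re hw).add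
      (integrable_inv_sub_sq_add_sq I.re hI)).const_mul ‖w - I‖).div_const 2)
    (ae_of_all _ fun t => by
      rw [norm_mul]
      exact (mul_le_of_le_one_left (norm_nonneg _) (hφ t)).trans
        (norm_one_div_sub_one_div_le t hw hI))
  simp only [Pi.add_apply] at h
  rwa [integral_div, integral_const_mul, integral_add (integrable_inv_sub_sq_add_sq w.re hw)
    (integrable_inv_sub_sq_add_sq I.re hI), integral_inv_sub_sq_add_sq _ hw,
    integral_inv_sub_sq_add_sq _ hI, I_im, abs_one, div_one] at h

lemma one_add_le_mul_exp {ε a : ℝ} (hε : 0 < ε) (ha : 0 ≤ a) :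
    a + 1 ≤ (1 + ε⁻¹) * Real.exp (ε * a) := by
  have h1 := Real.add_one_le_exp (ε * a)
  have h2 : ε⁻¹ * (ε * a) = a := by field_simp
  have h3 : ε⁻¹ * (ε * a) ≤ ε⁻¹ * Real.exp (ε * a) := by
    gcongr
    linarith
  nlinarith [mul_nonneg hε.le ha]

lemma norm_sub_I_div_pi_mul_le {w : ℂ} {δ M : ℝ} (hδ : 0 < δ) (hδw : δ ≤ |w.im|)
    (hM : |w.im| ≤ M) :
    ‖w - I‖ / Real.pi * (1 + (|w.re| + 1) / |w.im|) ≤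
      (M + 1) * (1 + δ⁻¹) * (|w.re| + 1) ^ 2 := by
  have hM0 : 0 ≤ M := (abs_nonneg _).trans hM
  have hnorm : ‖w - I‖ ≤ (M + 1) * (|w.re| + 1) := by
    have h1 := norm_sub_le w I
    have h2 := Complex.norm_le_abs_re_add_abs_im w
    rw [norm_I] at h1
    nlinarith [mul_nonneg hM0 (abs_nonneg w.re)]
  have hdiv : ‖w - I‖ / Real.pi ≤ ‖w - I‖ :=
    div_le_self (norm_nonneg _) (by linarith [Real.pi_gt_three])
  have hfac : 1 + (|w.re| + 1) / |w.im| ≤ (1 + δ⁻¹) * (|w.re| + 1) := by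
    have : (|w.re| + 1) / |w.im| ≤ (|w.re| + 1) / δ := by gcongr
    rw [div_eq_mul_inv _ δ] at this
    linarith [abs_nonneg w.re]
  calc _ ≤ ((M + 1) * (|w.re| + 1)) * ((1 + δ⁻¹) * (|w.re| + 1)) := by
        gcongr
        exact hdiv.trans hnorm
    _ = _ := by ring

theorem stmt_2 (μ : Measure ℝ) [IsProbabilityMeasure μ]
    (φ : ℝ → ℂ)
    (hφ : ∀ t : ℝ, φ t = ∫ x : ℝ, Complex.exp (I * t * x) ∂μ)
    (F : ℂ → ℂ)
    (hF : ∀ w : ℂ, w.im ≠ 0 →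
      F w = (1 / (2 * Real.pi * I)) *
        ∫ t : ℝ, φ t * (1 / ((t : ℂ) - w) - 1 / ((t : ℂ) - I))) :
    (∀ w : ℂ, w.im ≠ 0 →
      ‖F w‖ ≤ (‖w - I‖ / Real.pi) * (1 + (|w.re| + 1) / |w.im|)) ∧
    (∀ K : Set ℝ, IsCompact K → (0 : ℝ) ∉ K → ∀ ε : ℝ, 0 < ε →
      ∃ C : ℝ, 0 < C ∧ ∀ w : ℂ, w.im ∈ K →
        ‖F w‖ ≤ C * Real.exp (ε * |w.re|)) := by
  have hφ1 : ∀ t, ‖φ t‖ ≤ 1 := fun t => by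
    rw [hφ]
    refine (norm_integral_le_of_norm_le_const (C := 1) (ae_of_all _ fun x => ?_)).trans (by simp)
    rw [show I * t * x = ((t * x : ℝ) : ℂ) * I by push_cast; ring, norm_exp_ofReal_mul_I]
  have hbound : ∀ w : ℂ, w.im ≠ 0 →
      ‖F w‖ ≤ (‖w - I‖ / Real.pi) * (1 + (|w.re| + 1) / |w.im|) := fun w hw => by
    have hy : 0 < |w.im| := abs_pos.mpr hw
    have hpi := Real.pi_pos
    have hc : ‖1 / (2 * Real.pi * I : ℂ)‖ = 1 / (2 * Real.pi) := by
      simp [abs_of_pos hpi]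
    rw [hF w hw, norm_mul, hc]
    calc _ ≤ 1 / (2 * Real.pi) * (‖w - I‖ * (Real.pi / |w.im| + Real.pi) / 2) := by
          gcongr
          exact norm_integral_mul_one_div_sub_le hφ1 hw
      _ = ‖w - I‖ / Real.pi * (Real.pi / 4 * (1 + 1 / |w.im|)) := by
          field_simp
          ring
      _ ≤ ‖w - I‖ / Real.pi * (1 * (1 + (|w.re| + 1) / |w.im|)) := by
          gcongr
          · linarith [Real.pi_le_four]
          · linarith [abs_nonneg w.re]
      _ = _ := by rw [one_mul]
  refine ⟨hbound, fun K hK h0 ε hε => ?_⟩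
  obtain ⟨δ, hδ, hball⟩ := Metric.isOpen_iff.mp hK.isClosed.isOpen_compl 0 h0
  obtain ⟨M, hM0, hM⟩ := hK.isBounded.exists_pos_norm_le
  refine ⟨(M + 1) * (1 + δ⁻¹) * (1 + (ε / 2)⁻¹) ^ 2, by positivity, fun w hw => ?_⟩
  have hδw : δ ≤ |w.im| := by
    by_contra! h
    exact hball (by simpa using h) hw
  have hw0 : w.im ≠ 0 := fun h => h0 (h ▸ hw)
  calc ‖F w‖ ≤ (M + 1) * (1 + δ⁻¹) * (|w.re| + 1) ^ 2 :=
        (hbound w hw0).trans (norm_sub_I_div_pi_mul_le hδ hδw (hM _ hw))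
    _ ≤ (M + 1) * (1 + δ⁻¹) * ((1 + (ε / 2)⁻¹) * Real.exp (ε / 2 * |w.re|)) ^ 2 := by
        gcongr
        exact one_add_le_mul_exp (half_pos hε) (abs_nonneg _)
    _ = _ := by
        rw [mul_pow, ← Real.exp_nat_mul]
        push_cast
        rw [show 2 * (ε / 2 * |w.re|) = ε * |w.re| by ring]
        ring
end

section
/- Inversion formula: let μ be a probability measure on ℝ with characteristic function φ(t) = ∫_ℝ exp(itx) dμ(x). For y > 0 set P_y(x) = (1/(2π)) ( ∫_{−∞}^{0} exp(−i(x+iy)t) φ(t) dt + ∫_{0}^{∞} exp(−i(x−iy)t) φ(t) dt ). Then for every continuous compactly supported function g : ℝ → ℂ, lim_{y→0+} ∫_ℝ P_y(x) g(x) dx = ∫_ℝ g(x) dμ(x). In other words, the Fourier transform of the hyperfunction corresponding to φ equals 2π times the hyperfunction corresponding to μ. -/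
open MeasureTheory Complex Filter Topology

theorem integral_mul_charFun_eq (μ ν : Measure ℝ) [IsProbabilityMeasure μ] [SFinite ν]
    {f : ℝ → ℂ} (hf : Integrable f ν) :
    ∫ t, f t * ∫ s : ℝ, cexp (I * t * s) ∂μ ∂ν = ∫ s : ℝ, ∫ t, f t * cexp (I * t * s) ∂ν ∂μ := by
  simp_rw [← integral_const_mul]
  refine integral_integral_swap ?_
  refine (hf.comp_fst μ).mul_bdd (c := 1) ?_ ?_
  · exact Continuous.aestronglyMeasurable (by fun_prop)
  · refine ae_of_all _ fun p => ?_
    rw [Complex.norm_exp]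
    simp

theorem inv_add_inv_eq_poisson {y : ℝ} (hy : 0 < y) (u : ℝ) :
    ((y : ℂ) + u * I)⁻¹ + ((y : ℂ) - u * I)⁻¹ = ((2 * y / (y ^ 2 + u ^ 2) : ℝ) : ℂ) := by
  have h1 : (y : ℂ) + u * I ≠ 0 := fun h => hy.ne' (by simpa using congrArg re h)
  have h2 : (y : ℂ) - u * I ≠ 0 := fun h => hy.ne' (by simpa using congrArg re h)
  have h3 : ((y : ℂ) ^ 2 + u ^ 2) = (y + u * I) * (y - u * I) := by
    ring_nf; simp
  push_cast
  rw [h3]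
  field_simp
  ring

theorem half_line_fourier_sum_eq (μ : Measure ℝ) [IsProbabilityMeasure μ] {y : ℝ} (hy : 0 < y)
    (x : ℝ) :
    (∫ t in Set.Iio (0 : ℝ), cexp (-I * ((x : ℂ) + (y : ℂ) * I) * t) *
        ∫ s : ℝ, cexp (I * t * s) ∂μ) +
      ∫ t in Set.Ioi (0 : ℝ), cexp (-I * ((x : ℂ) - (y : ℂ) * I) * t) *
        ∫ s : ℝ, cexp (I * t * s) ∂μ
      = ∫ s : ℝ, ((2 * y / (y ^ 2 + (x - s) ^ 2) : ℝ) : ℂ) ∂μ := by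
  have hneg : 0 < (-I * ((x : ℂ) + (y : ℂ) * I)).re := by simpa
  have hpos : (-I * ((x : ℂ) - (y : ℂ) * I)).re < 0 := by simpa
  have hnorm : ∀ u : ℝ, y ≤ ‖(y : ℂ) + u * I‖ := fun u => by
    simpa [abs_of_pos hy] using Complex.abs_re_le_norm ((y : ℂ) + u * I)
  have hint : ∀ c : ℝ, Integrable (fun s : ℝ => ((y : ℂ) + (c * (x - s) : ℝ) * I)⁻¹) μ := by
    intro c
    refine Integrable.of_bound (C := y⁻¹) (Measurable.aestronglyMeasurable (by fun_prop))
      (ae_of_all _ fun s => ?_)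
    rw [norm_inv]
    gcongr
    exact hnorm _
  rw [integral_mul_charFun_eq μ _ ((integrableOn_exp_mul_complex_Iic hneg 0).mono_set
      Set.Iio_subset_Iic_self),
    integral_mul_charFun_eq μ _ (integrableOn_exp_mul_complex_Ioi hpos 0)]
  have e1 : ∀ s : ℝ, ∫ t in Set.Iio (0 : ℝ), cexp (-I * ((x : ℂ) + (y : ℂ) * I) * t) *
      cexp (I * t * s) = ((y : ℂ) + ((-1) * (x - s) : ℝ) * I)⁻¹ := by
    intro s
    have hre : 0 < ((y : ℂ) + ((-1) * (x - s) : ℝ) * I).re := by simpa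
    have h := integral_exp_mul_complex_Iic hre 0
    rw [integral_Iic_eq_integral_Iio] at h
    simp only [ofReal_zero, mul_zero, Complex.exp_zero, one_div] at h
    rw [← h]
    congr 1 with t
    rw [← Complex.exp_add]
    congr 1
    push_cast
    linear_combination (-(y : ℂ) * t) * I_sq
  have e2 : ∀ s : ℝ, ∫ t in Set.Ioi (0 : ℝ), cexp (-I * ((x : ℂ) - (y : ℂ) * I) * t) *
      cexp (I * t * s) = ((y : ℂ) + (1 * (x - s) : ℝ) * I)⁻¹ := by
    intro s
    have hre : (-((y : ℂ) + (1 * (x - s) : ℝ) * I)).re < 0 := by simpa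
    have h := integral_exp_mul_complex_Ioi hre 0
    simp only [ofReal_zero, mul_zero, Complex.exp_zero, neg_div_neg_eq, one_div] at h
    rw [← h]
    congr 1 with t
    rw [← Complex.exp_add]
    congr 1
    push_cast
    linear_combination ((y : ℂ) * t) * I_sq
  simp_rw [e1, e2]
  rw [← integral_add (hint (-1)) (hint 1)]
  congr 1 with s
  rw [← inv_add_inv_eq_poisson hy (x - s), add_comm]
  push_cast
  ring_nf

theorem integral_poisson_mul_eq {y : ℝ} (hy : 0 < y) (g : ℝ → ℂ) (s : ℝ) :
    ∫ x : ℝ, ((2 * y / (y ^ 2 + (x - s) ^ 2) : ℝ) : ℂ) * g x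
      = ∫ u : ℝ, ((2 * (1 + u ^ 2)⁻¹ : ℝ) : ℂ) * g (s + y * u) := by
  rw [← integral_add_left_eq_self _ s]
  have h := Measure.integral_comp_mul_left
    (fun x : ℝ => ((2 * y / (y ^ 2 + (s + x - s) ^ 2) : ℝ) : ℂ) * g (s + x)) y
  rw [abs_of_pos (inv_pos.2 hy), eq_inv_smul_iff₀ hy.ne', ← integral_smul] at h
  rw [← h]
  congr 1 with u
  rw [real_smul, ← mul_assoc, ← ofReal_mul]
  congr 2
  have : 0 < 1 + u ^ 2 := by positivity
  have : y ^ 2 + (s + y * u - s) ^ 2 = y ^ 2 * (1 + u ^ 2) := by ring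
  rw [this]
  field_simp

theorem tendsto_integral_poisson (μ : Measure ℝ) [IsProbabilityMeasure μ]
    {g : ℝ → ℂ} (hg : Continuous g) {C : ℝ} (hC : ∀ x, ‖g x‖ ≤ C) :
    Tendsto (fun y : ℝ => ∫ s, (∫ u : ℝ, ((2 * (1 + u ^ 2)⁻¹ : ℝ) : ℂ) * g (s + y * u)) ∂μ)
      (𝓝[>] 0) (𝓝 (∫ s, (2 * Real.pi) * g s ∂μ)) := by
  have hk : Integrable (fun u : ℝ => 2 * (1 + u ^ 2)⁻¹) := integrable_inv_one_add_sq.const_mul 2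
  have hbound : ∀ y s u : ℝ, ‖((2 * (1 + u ^ 2)⁻¹ : ℝ) : ℂ) * g (s + y * u)‖
      ≤ 2 * (1 + u ^ 2)⁻¹ * C := fun y s u => by
    rw [norm_mul, norm_real, Real.norm_of_nonneg (by positivity)]
    gcongr
    exact hC _
  have hcont : ∀ y : ℝ, Continuous fun p : ℝ × ℝ =>
      ((2 * (1 + p.2 ^ 2)⁻¹ : ℝ) : ℂ) * g (p.1 + y * p.2) := fun y => by
    have : Continuous fun p : ℝ × ℝ => (1 + p.2 ^ 2)⁻¹ :=
      Continuous.inv₀ (by fun_prop) fun p => by positivity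
    fun_prop
  refine tendsto_integral_filter_of_dominated_convergence
    (fun _ => ∫ u : ℝ, 2 * (1 + u ^ 2)⁻¹ * C) ?_ ?_ (integrable_const _) ?_
  · exact Eventually.of_forall fun y =>
      ((hcont y).stronglyMeasurable.integral_prod_right (ν := volume)).aestronglyMeasurable
  · exact Eventually.of_forall fun y => ae_of_all _ fun s =>
      norm_integral_le_of_norm_le (hk.mul_const C) (ae_of_all _ (hbound y s))
  · refine ae_of_all _ fun s => ?_
    have hlim : (2 * Real.pi : ℂ) * g s = ∫ u : ℝ, ((2 * (1 + u ^ 2)⁻¹ : ℝ) : ℂ) * g s := by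
      rw [integral_mul_const, integral_complex_ofReal, integral_const_mul, integral_univ_inv_one_add_sq]
      push_cast
      rfl
    rw [hlim]
    refine tendsto_integral_filter_of_dominated_convergence
      (fun u : ℝ => 2 * (1 + u ^ 2)⁻¹ * C) ?_ ?_ (hk.mul_const C) ?_
    · exact Eventually.of_forall fun y =>
        ((hcont y).comp (Continuous.prodMk_right s)).aestronglyMeasurable
    · exact Eventually.of_forall fun y => ae_of_all _ (hbound y s)
    · refine ae_of_all _ fun u => Tendsto.const_mul _ ?_
      have : Continuous fun y : ℝ => g (s + y * u) := by fun_prop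
      simpa using (this.tendsto 0).mono_left nhdsWithin_le_nhds

theorem integral_poisson_swap (μ : Measure ℝ) [IsProbabilityMeasure μ] {y : ℝ} (hy : 0 < y)
    {g : ℝ → ℂ} (hg : Integrable g) :
    ∫ x : ℝ, (∫ s : ℝ, ((2 * y / (y ^ 2 + (x - s) ^ 2) : ℝ) : ℂ) ∂μ) * g x
      = ∫ s : ℝ, (∫ x : ℝ, ((2 * y / (y ^ 2 + (x - s) ^ 2) : ℝ) : ℂ) * g x) ∂μ := by
  simp_rw [← integral_mul_const]
  refine integral_integral_swap ?_
  refine (hg.comp_fst μ).bdd_mul (c := 2 * y / y ^ 2)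
    (Measurable.aestronglyMeasurable (by fun_prop)) (ae_of_all _ fun p => ?_)
  rw [norm_real, Real.norm_of_nonneg (by positivity)]
  gcongr
  nlinarith [sq_nonneg (p.1 - p.2)]

theorem stmt_6 (μ : Measure ℝ) [IsProbabilityMeasure μ]
    (φ : ℝ → ℂ)
    (hφ : ∀ t : ℝ, φ t = ∫ x : ℝ, Complex.exp (I * t * x) ∂μ)
    (P : ℝ → ℝ → ℂ)
    (hP : ∀ y : ℝ, 0 < y → ∀ x : ℝ,
      P y x = (1 / (2 * Real.pi)) *
        ((∫ t in Set.Iio (0 : ℝ), Complex.exp (-I * ((x : ℂ) + (y : ℂ) * I) * t) * φ t) +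
          ∫ t in Set.Ioi (0 : ℝ), Complex.exp (-I * ((x : ℂ) - (y : ℂ) * I) * t) * φ t)) :
    ∀ g : ℝ → ℂ, Continuous g → HasCompactSupport g →
      Tendsto (fun y : ℝ => ∫ x : ℝ, P y x * g x)
        (𝓝[>] 0)
        (𝓝 (∫ x : ℝ, g x ∂μ)) := by
  intro g hg hgc
  obtain ⟨C, hC⟩ := hgc.exists_bound_of_continuous hg
  have h := (tendsto_integral_poisson μ hg hC).const_mul (1 / (2 * Real.pi) : ℂ)
  have hpi : (2 * Real.pi : ℂ) ≠ 0 := by simp [Real.pi_ne_zero]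
  rw [integral_const_mul, ← mul_assoc, one_div_mul_cancel hpi, one_mul] at h
  refine h.congr' ?_
  filter_upwards [self_mem_nhdsWithin] with y (hy : 0 < y)
  simp_rw [hP y hy, hφ, half_line_fourier_sum_eq μ hy, mul_assoc _ _ (g _)]
  rw [integral_const_mul, integral_poisson_swap μ hy (hg.integrable_of_hasCompactSupport hgc)]
  simp_rw [integral_poisson_mul_eq hy]
end

section
/- Let d ≥ 3 be an integer and θ, θ' ∈ ℝ with |θ − θ'| < π/d. Then for every w ∈ ℂ with Im(w e^{iθd}) > 0 and Im(w e^{iθ'd}) > 0, one has φ_θ(w) = φ_{θ'}(w). -/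
open MeasureTheory Complex Filter Topology

noncomputable def phiTheta (d : ℕ) (θ : ℝ) (w : ℂ) : ℂ :=
  (1 / Real.sqrt (2 * Real.pi)) *
    ∫ t in Set.Ioi (0 : ℝ),
      Complex.exp (Complex.I * w * Complex.exp (Complex.I * θ * d) * (t : ℂ) ^ d
          - (1 / 2) * Complex.exp (2 * Complex.I * θ) * (t : ℂ) ^ 2) *
        Complex.exp (Complex.I * θ)

/-- If an entire function decays exponentially, uniformly on the sector between two rays from the
origin, then its integrals along the two rays agree. -/
lemma integral_ray_eq_of_exp_decay {f : ℂ → ℂ} (hf : Differentiable ℂ f) {a b : ℝ} (hab : a ≤ b)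
    (hb : ∀ᶠ R : ℝ in atTop, ∀ η ∈ Set.Icc a b,
      ‖f (R * Complex.exp (Complex.I * η))‖ ≤ Real.exp (-R)) :
    ∫ t in Set.Ioi (0 : ℝ), f (t * Complex.exp (Complex.I * a)) * Complex.exp (Complex.I * a) =
      ∫ t in Set.Ioi (0 : ℝ),
        f (t * Complex.exp (Complex.I * b)) * Complex.exp (Complex.I * b) := by
  obtain ⟨F, hF⟩ := hf.isExactOn_univ
  have hF' : ∀ z, HasDerivAt F (f z) z := fun z => hF z (Set.mem_univ z)
  have hcont : ∀ η : ℝ, Continuous fun t : ℝ =>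
      f (t * Complex.exp (Complex.I * η)) * Complex.exp (Complex.I * η) := fun η => by
    have := hf.continuous
    fun_prop
  have hnorm : ∀ η : ℝ, ‖Complex.exp (Complex.I * η)‖ = 1 := fun η => by
    rw [mul_comm, Complex.norm_exp_ofReal_mul_I]
  have hintegrable : ∀ η ∈ Set.Icc a b, IntegrableOn (fun t : ℝ =>
      f (t * Complex.exp (Complex.I * η)) * Complex.exp (Complex.I * η)) (Set.Ioi 0) := by
    intro η hη
    refine (integrable_norm_iff (hcont η).aestronglyMeasurable).1 ?_
    refine integrable_of_isBigO_exp_neg one_pos (hcont η).norm.continuousOn ?_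
    refine Asymptotics.IsBigO.of_bound 1 ?_
    filter_upwards [hb] with R hR
    simpa [hnorm] using hR η hη
  have hlim : ∀ η ∈ Set.Icc a b, Tendsto
      (fun R : ℝ => F (R * Complex.exp (Complex.I * η)) - F 0) atTop
      (𝓝 (∫ t in Set.Ioi (0 : ℝ),
        f (t * Complex.exp (Complex.I * η)) * Complex.exp (Complex.I * η))) := by
    intro η hη
    refine (intervalIntegral_tendsto_integral_Ioi 0 (hintegrable η hη) tendsto_id).congr fun R => ?_
    rw [id, intervalIntegral.integral_eq_sub_of_hasDerivAt
      (f := fun t : ℝ => F (t * Complex.exp (Complex.I * η))) ?_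
      ((hcont η).intervalIntegrable _ _)]
    · simp
    · intro t _
      have h : HasDerivAt (fun t : ℝ => (t : ℂ) * Complex.exp (Complex.I * η))
          (1 * Complex.exp (Complex.I * η)) t := (Complex.ofRealCLM.hasDerivAt).mul_const _
      rw [one_mul] at h
      exact (hF' _).comp t h
  have harc : Tendsto (fun R : ℝ => (F (R * Complex.exp (Complex.I * b)) - F 0) -
      (F (R * Complex.exp (Complex.I * a)) - F 0)) atTop (𝓝 0) := by
    have hdecay : Tendsto (fun R : ℝ => R ^ 1 * Real.exp (-R) * (b - a)) atTop (𝓝 0) := by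
      simpa using (Real.tendsto_pow_mul_exp_neg_atTop_nhds_zero 1).mul_const (b - a)
    refine squeeze_zero_norm' ?_ hdecay
    filter_upwards [hb, eventually_ge_atTop 0] with R hR hR0
    rw [sub_sub_sub_cancel_right]
    refine norm_image_sub_le_of_norm_deriv_le_segment'
      (f := fun η : ℝ => F (R * Complex.exp (Complex.I * η)))
      (f' := fun η : ℝ => f (R * Complex.exp (Complex.I * η)) *
        (R * (Complex.exp (Complex.I * η) * Complex.I)))
      (fun η _ => ?_) (fun η hη => ?_) b (Set.right_mem_Icc.2 hab)
    · have h : HasDerivAt (fun η : ℝ => (R : ℂ) * Complex.exp (Complex.I * η))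
          (R * (Complex.exp (Complex.I * η) * (Complex.I * 1))) η :=
        (((Complex.ofRealCLM.hasDerivAt (x := η)).const_mul Complex.I).cexp).const_mul (R : ℂ)
      rw [mul_one] at h
      exact ((hF' _).comp η h).hasDerivWithinAt
    · have h := mul_le_mul_of_nonneg_left (hR η (Set.Ico_subset_Icc_self hη)) hR0
      simpa [hnorm, abs_of_nonneg hR0, mul_comm] using h
  have h := (hlim b (Set.right_mem_Icc.2 hab)).sub (hlim a (Set.left_mem_Icc.2 hab))
  exact (sub_eq_zero.1 (tendsto_nhds_unique h harc)).symm

/-- If rotating `w` by the angles `a * d` and `b * d`, less than `π` apart, gives points of the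
open upper half-plane, then so does every rotation in between. -/
lemma im_mul_exp_pos_of_mem_Icc {d a b : ℝ} (hd : 0 < d) (hab : (b - a) * d < Real.pi) {w : ℂ}
    (ha : 0 < (w * Complex.exp (Complex.I * a * d)).im)
    (hb : 0 < (w * Complex.exp (Complex.I * b * d)).im) {η : ℝ} (hη : η ∈ Set.Icc a b) :
    0 < (w * Complex.exp (Complex.I * η * d)).im := by
  have him : ∀ x : ℝ, (w * Complex.exp (Complex.I * x * d)).im =
      w.re * Real.sin (x * d) + w.im * Real.cos (x * d) := fun x => by
    rw [show Complex.I * x * d = ((x * d : ℝ) : ℂ) * Complex.I by push_cast; ring,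
      Complex.mul_im, Complex.exp_ofReal_mul_I_re, Complex.exp_ofReal_mul_I_im]
  rcases hη.1.eq_or_lt with rfl | h1
  · exact ha
  rcases hη.2.eq_or_lt with rfl | h2
  · exact hb
  rw [him] at *
  have hs : ∀ x y : ℝ, a ≤ x → x < y → y ≤ b → 0 < Real.sin (y * d - x * d) := by
    intro x y hx hxy hy
    apply Real.sin_pos_of_pos_of_lt_pi <;> nlinarith
  have hS := hs a b le_rfl (h1.trans h2) le_rfl
  have hA := mul_pos (hs η b h1.le h2 le_rfl) ha
  have hB := mul_pos (hs a η le_rfl h1 h2.le) hb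
  refine pos_of_mul_pos_right (a := Real.sin (b * d - a * d)) ?_ hS.le
  rw [Real.sin_sub] at *
  nlinarith

theorem stmt_11 (d : ℕ) (hd : 3 ≤ d) (θ θ' : ℝ) (hθθ' : |θ - θ'| < Real.pi / d)
    (w : ℂ)
    (hw : 0 < (w * Complex.exp (Complex.I * θ * d)).im)
    (hw' : 0 < (w * Complex.exp (Complex.I * θ' * d)).im) :
    phiTheta d θ w = phiTheta d θ' w := by
  wlog hle : θ ≤ θ' generalizing θ θ'
  · exact (this θ' θ (by rwa [abs_sub_comm]) hw' hw (le_of_not_ge hle)).symm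
  have hd0 : (0 : ℝ) < d := by positivity
  have hgap : (θ' - θ) * d < Real.pi := by
    rw [abs_sub_comm, abs_of_nonneg (sub_nonneg.2 hle)] at hθθ'
    exact (lt_div_iff₀ hd0).1 hθθ'
  obtain ⟨η₀, hη₀, hmin⟩ := isCompact_Icc.exists_isMinOn (Set.nonempty_Icc.2 hle)
    (f := fun η : ℝ => (w * Complex.exp (Complex.I * η * d)).im) (by fun_prop)
  set c := (w * Complex.exp (Complex.I * η₀ * d)).im with hc
  have hc0 : 0 < c :=
    im_mul_exp_pos_of_mem_Icc hd0 hgap (by exact_mod_cast hw) (by exact_mod_cast hw') hη₀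
  have hdecay : ∀ᶠ R : ℝ in atTop, ∀ η ∈ Set.Icc θ θ',
      ‖(fun z : ℂ => Complex.exp (Complex.I * w * z ^ d - (1 / 2) * z ^ 2))
        (R * Complex.exp (Complex.I * η))‖ ≤ Real.exp (-R) := by
    filter_upwards [(Asymptotics.isLittleO_pow_pow_atTop_of_lt (𝕜 := ℝ)
      (show 2 < d by omega)).bound (half_pos hc0), eventually_ge_atTop 2] with R hR hR2 η hη
    have hRd : 0 ≤ R ^ d := by positivity
    rw [Real.norm_of_nonneg (by positivity), Real.norm_of_nonneg hRd] at hR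
    have hcη : c ≤ (w * Complex.exp (Complex.I * η * d)).im := hmin hη
    have hre : (Complex.I * w * (R * Complex.exp (Complex.I * η)) ^ d).re =
        -((w * Complex.exp (Complex.I * η * d)).im * R ^ d) := by
      rw [mul_pow, ← Complex.exp_nat_mul, mul_comm (d : ℂ),
        show Complex.I * w * ((R : ℂ) ^ d * Complex.exp (Complex.I * η * d)) =
          Complex.I * ((w * Complex.exp (Complex.I * η * d)) * ((R ^ d : ℝ) : ℂ)) by
            push_cast; ring,
        Complex.I_mul_re, Complex.im_mul_ofReal]
    have hre2 : -((1 / 2) * (R * Complex.exp (Complex.I * η)) ^ 2 : ℂ).re ≤ R ^ 2 / 2 := by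
      refine (neg_le_abs _).trans ((Complex.abs_re_le_norm _).trans_eq ?_)
      rw [norm_mul, norm_pow, norm_mul, mul_comm Complex.I, Complex.norm_exp_ofReal_mul_I]
      simp
      ring
    rw [Complex.norm_exp, Real.exp_le_exp, Complex.sub_re, hre]
    nlinarith [mul_le_mul_of_nonneg_right hcη hRd]
  have h := integral_ray_eq_of_exp_decay (f := fun z : ℂ =>
    Complex.exp (Complex.I * w * z ^ d - (1 / 2) * z ^ 2)) (by fun_prop) hle hdecay
  have hphi : ∀ η : ℝ, phiTheta d η w = (1 / Real.sqrt (2 * Real.pi)) *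
      ∫ t in Set.Ioi (0 : ℝ), Complex.exp (Complex.I * w * (t * Complex.exp (Complex.I * η)) ^ d -
        (1 / 2) * (t * Complex.exp (Complex.I * η)) ^ 2) * Complex.exp (Complex.I * η) := by
    intro η
    unfold phiTheta
    congr 3 with t
    rw [mul_pow, mul_pow, ← Complex.exp_nat_mul, ← Complex.exp_nat_mul]
    push_cast
    ring_nf
  rw [hphi, hphi, h]
end

section
/- Let d ≥ 3 and n ≥ 1 be integers, and let θ, θ', φ ∈ ℝ satisfy Im(e^{i(φ+θd)}) ≥ 0, Im(e^{i(φ+θ'd)}) ≥ 0, cos(2θ) > 0 and cos(2θ') > 0. Then for every z ∈ ℂ with Im(z e^{iφ}) < 0 (i.e. z ∈ −e^{−iφ}ℍ), the function s ↦ exp(−i z e^{iφ} s) (φ_θ(e^{iφ}s) − φ_{θ'}(e^{iφ}s))^n is absolutely integrable on (0, ∞); consequently the integral ψ(z; θ, θ', φ) = ∫_0^∞ exp(−i z e^{iφ} s) (φ_θ(e^{iφ}s) − φ_{θ'}(e^{iφ}s))^n e^{iφ} ds converges. -/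
open MeasureTheory Complex Filter Topology

noncomputable def psiFn (d n : ℕ) (θ θ' φ : ℝ) (z : ℂ) : ℂ :=
  ∫ s in Set.Ioi (0 : ℝ),
    Complex.exp (-Complex.I * z * Complex.exp (Complex.I * φ) * s) *
        (phiTheta d θ (Complex.exp (Complex.I * φ) * s) -
          phiTheta d θ' (Complex.exp (Complex.I * φ) * s)) ^ n *
      Complex.exp (Complex.I * φ)

theorem continuous_phiTheta_integrand (d : ℕ) (θ : ℝ) :
    Continuous fun p : ℂ × ℝ =>
      exp (I * p.1 * exp (I * θ * d) * (p.2 : ℂ) ^ d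
          - (1 / 2) * exp (2 * I * θ) * (p.2 : ℂ) ^ 2) * exp (I * θ) := by
  fun_prop

theorem measurable_phiTheta (d : ℕ) (θ : ℝ) : Measurable (phiTheta d θ) := by
  have h := (continuous_phiTheta_integrand d θ).stronglyMeasurable.integral_prod_right'
    (ν := volume.restrict (Set.Ioi (0 : ℝ)))
  exact h.measurable.const_mul _

theorem norm_phiTheta_integrand_le (d : ℕ) (θ : ℝ) {w : ℂ}
    (hw : 0 ≤ (w * exp (I * θ * d)).im) {t : ℝ} (ht : 0 ≤ t) :
    ‖exp (I * w * exp (I * θ * d) * (t : ℂ) ^ d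
        - (1 / 2) * exp (2 * I * θ) * (t : ℂ) ^ 2) * exp (I * θ)‖ ≤
      Real.exp (-(Real.cos (2 * θ) / 2) * t ^ 2) := by
  have hone : ‖exp (I * θ)‖ = 1 := by rw [mul_comm, norm_exp_ofReal_mul_I]
  have hexp : (exp (2 * I * θ)).re = Real.cos (2 * θ) := by
    rw [← exp_ofReal_mul_I_re]
    push_cast
    ring_nf
  have hfirst : (I * w * exp (I * θ * d) * (t : ℂ) ^ d).re
      = -((w * exp (I * θ * d)).im * t ^ d) := by
    rw [← ofReal_pow, re_mul_ofReal, mul_assoc I, I_mul_re, neg_mul]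
  have hsecond : ((1 / 2) * exp (2 * I * θ) * (t : ℂ) ^ 2).re
      = Real.cos (2 * θ) / 2 * t ^ 2 := by
    rw [← ofReal_pow, re_mul_ofReal, ← hexp, one_div, ← div_eq_inv_mul, div_ofNat_re]
  rw [norm_mul, hone, mul_one, norm_exp, sub_re, hfirst, hsecond, Real.exp_le_exp]
  have := mul_nonneg hw (pow_nonneg ht d)
  linarith

theorem norm_phiTheta_le (d : ℕ) {θ : ℝ} (hθ : 0 < Real.cos (2 * θ)) {w : ℂ}
    (hw : 0 ≤ (w * exp (I * θ * d)).im) :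
    ‖phiTheta d θ w‖ ≤ ‖(1 / Real.sqrt (2 * Real.pi) : ℂ)‖ *
      ∫ t in Set.Ioi (0 : ℝ), Real.exp (-(Real.cos (2 * θ) / 2) * t ^ 2) := by
  rw [phiTheta, norm_mul]
  refine mul_le_mul_of_nonneg_left ?_ (norm_nonneg _)
  refine norm_integral_le_of_norm_le (integrable_exp_neg_mul_sq (half_pos hθ)).integrableOn ?_
  filter_upwards [ae_restrict_mem measurableSet_Ioi] with t ht
  exact norm_phiTheta_integrand_le d θ hw (Set.mem_Ioi.mp ht).le

theorem im_ray_mul_exp_nonneg (d : ℕ) {θ φ : ℝ} (h : 0 ≤ (exp (I * (φ + θ * d))).im)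
    {s : ℝ} (hs : 0 ≤ s) : 0 ≤ (exp (I * φ) * s * exp (I * θ * d)).im := by
  rw [mul_right_comm, ← exp_add, im_mul_ofReal, mul_assoc I, ← mul_add]
  exact mul_nonneg h hs

theorem integrableOn_exp_neg_I_mul_ofReal {a : ℂ} (ha : a.im < 0) :
    IntegrableOn (fun s : ℝ => exp (-I * a * s)) (Set.Ioi 0) := by
  refine integrableOn_exp_mul_complex_Ioi ?_ 0
  simpa using ha

theorem stmt_13 (d n : ℕ) (hd : 3 ≤ d) (hn : 1 ≤ n) (θ θ' φ : ℝ)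
    (h1 : 0 ≤ (Complex.exp (Complex.I * (φ + θ * d))).im)
    (h2 : 0 ≤ (Complex.exp (Complex.I * (φ + θ' * d))).im)
    (h3 : 0 < Real.cos (2 * θ)) (h4 : 0 < Real.cos (2 * θ'))
    (z : ℂ) (hz : (z * Complex.exp (Complex.I * φ)).im < 0) :
    IntegrableOn
      (fun s : ℝ =>
        Complex.exp (-Complex.I * z * Complex.exp (Complex.I * φ) * s) *
          (phiTheta d θ (Complex.exp (Complex.I * φ) * s) -
            phiTheta d θ' (Complex.exp (Complex.I * φ) * s)) ^ n)
      (Set.Ioi 0) volume := by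
  have hdecay := integrableOn_exp_neg_I_mul_ofReal hz
  simp only [← mul_assoc] at hdecay
  have hmeas (η : ℝ) : Measurable fun s : ℝ => phiTheta d η (exp (I * φ) * s) :=
    (measurable_phiTheta d η).comp (by fun_prop)
  refine hdecay.mul_bdd (((hmeas θ).sub (hmeas θ')).pow_const n).aestronglyMeasurable ?_
    (c := (‖(1 / Real.sqrt (2 * Real.pi) : ℂ)‖ *
        (∫ t in Set.Ioi (0 : ℝ), Real.exp (-(Real.cos (2 * θ) / 2) * t ^ 2)) +
      ‖(1 / Real.sqrt (2 * Real.pi) : ℂ)‖ *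
        ∫ t in Set.Ioi (0 : ℝ), Real.exp (-(Real.cos (2 * θ') / 2) * t ^ 2)) ^ n)
  filter_upwards [ae_restrict_mem measurableSet_Ioi] with s hs
  have hs' : 0 ≤ s := (Set.mem_Ioi.mp hs).le
  rw [norm_pow]
  refine pow_le_pow_left₀ (norm_nonneg _) ((norm_sub_le _ _).trans ?_) n
  exact add_le_add (norm_phiTheta_le d h3 (im_ray_mul_exp_nonneg d h1 hs'))
    (norm_phiTheta_le d h4 (im_ray_mul_exp_nonneg d h2 hs'))
end

section
/- Let d ≥ 3 and n ≥ 1 be integers, let θ, θ' ∈ ℝ with cos(2θ) > 0 and cos(2θ') > 0, and let φ₁, φ₂ ∈ ℝ with |φ₁ − φ₂| < π satisfy Im(e^{i(φ_k+θd)}) ≥ 0 and Im(e^{i(φ_k+θ'd)}) ≥ 0 for k = 1, 2. Then for every z ∈ ℂ with Im(z e^{iφ₁}) < 0 and Im(z e^{iφ₂}) < 0, one has ψ(z; θ, θ', φ₁) = ψ(z; θ, θ', φ₂). -/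
open MeasureTheory Complex Filter Topology

theorem gaussianPhase_norm_le {a b c w : ℂ} {d : ℕ} {t : ℝ} (ht : 0 ≤ t)
    (hw : 0 ≤ (w * c).im) :
    ‖Complex.exp (Complex.I * w * c * (t : ℂ) ^ d - a * (t : ℂ) ^ 2) * b‖ ≤
      Real.exp (-a.re * t ^ 2) * ‖b‖ := by
  rw [norm_mul, Complex.norm_exp]
  gcongr
  have h1 : (Complex.I * w * c * (t : ℂ) ^ d).re = -((w * c).im * t ^ d) := by
    rw [mul_assoc Complex.I, ← Complex.ofReal_pow, Complex.re_mul_ofReal, Complex.I_mul_re]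
    ring
  have h2 : (a * (t : ℂ) ^ 2).re = a.re * t ^ 2 := by
    rw [← Complex.ofReal_pow, Complex.re_mul_ofReal]
  rw [Complex.sub_re, h1, h2]
  have : 0 ≤ (w * c).im * t ^ d := by positivity
  linarith

theorem integrableOn_pow_mul_exp_neg_mul_sq {r : ℝ} (hr : 0 < r) (d : ℕ) :
    IntegrableOn (fun t : ℝ => t ^ d * Real.exp (-r * t ^ 2)) (Set.Ioi 0) := by
  have hd : (-1 : ℝ) < d := by linarith [(Nat.cast_nonneg d : (0 : ℝ) ≤ d)]
  simpa only [Real.rpow_natCast] using integrableOn_rpow_mul_exp_neg_mul_sq hr hd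

theorem continuousOn_integral_gaussianPhase {a : ℂ} (b c : ℂ) (d : ℕ) (ha : 0 < a.re) :
    ContinuousOn (fun w : ℂ => ∫ t in Set.Ioi (0 : ℝ),
      Complex.exp (Complex.I * w * c * (t : ℂ) ^ d - a * (t : ℂ) ^ 2) * b)
      {w | 0 ≤ (w * c).im} := by
  refine continuousOn_of_dominated (bound := fun t => Real.exp (-a.re * t ^ 2) * ‖b‖)
    (fun w _ => ?_) (fun w hw => ?_) ?_ ?_
  · exact Continuous.aestronglyMeasurable (by fun_prop)
  · filter_upwards [ae_restrict_mem measurableSet_Ioi] with t ht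
    exact gaussianPhase_norm_le (le_of_lt ht) hw
  · exact (integrable_exp_neg_mul_sq ha).integrableOn.mul_const _
  · exact ae_of_all _ fun t => by fun_prop

theorem norm_integral_gaussianPhase_le {a b c w : ℂ} {d : ℕ} (ha : 0 < a.re)
    (hw : 0 ≤ (w * c).im) :
    ‖∫ t in Set.Ioi (0 : ℝ),
      Complex.exp (Complex.I * w * c * (t : ℂ) ^ d - a * (t : ℂ) ^ 2) * b‖ ≤
    ∫ t in Set.Ioi (0 : ℝ), Real.exp (-a.re * t ^ 2) * ‖b‖ := by
  refine norm_integral_le_of_norm_le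
    ((integrable_exp_neg_mul_sq ha).integrableOn.mul_const _) ?_
  filter_upwards [ae_restrict_mem measurableSet_Ioi] with t ht
  exact gaussianPhase_norm_le (le_of_lt ht) hw

theorem hasDerivAt_integral_gaussianPhase {a b c w : ℂ} {d : ℕ} (ha : 0 < a.re)
    (hw : 0 < (w * c).im) :
    HasDerivAt (fun w : ℂ => ∫ t in Set.Ioi (0 : ℝ),
        Complex.exp (Complex.I * w * c * (t : ℂ) ^ d - a * (t : ℂ) ^ 2) * b)
      (∫ t in Set.Ioi (0 : ℝ), (Complex.I * c * (t : ℂ) ^ d) *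
        (Complex.exp (Complex.I * w * c * (t : ℂ) ^ d - a * (t : ℂ) ^ 2) * b)) w ∧
    ‖∫ t in Set.Ioi (0 : ℝ), (Complex.I * c * (t : ℂ) ^ d) *
        (Complex.exp (Complex.I * w * c * (t : ℂ) ^ d - a * (t : ℂ) ^ 2) * b)‖ ≤
      ∫ t in Set.Ioi (0 : ℝ), t ^ d * Real.exp (-a.re * t ^ 2) * (‖c‖ * ‖b‖) := by
  have hbound : ∀ᵐ (t : ℝ) ∂(volume.restrict (Set.Ioi (0 : ℝ))), ∀ w ∈ {w : ℂ | 0 < (w * c).im},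
      ‖(Complex.I * c * (t : ℂ) ^ d) *
        (Complex.exp (Complex.I * w * c * (t : ℂ) ^ d - a * (t : ℂ) ^ 2) * b)‖ ≤
      t ^ d * Real.exp (-a.re * t ^ 2) * (‖c‖ * ‖b‖) := by
    filter_upwards [ae_restrict_mem measurableSet_Ioi] with t ht w hw
    have ht' : (0 : ℝ) ≤ t := le_of_lt ht
    have h1 : ‖Complex.I * c * (t : ℂ) ^ d‖ = t ^ d * ‖c‖ := by
      rw [norm_mul, norm_mul, norm_pow, Complex.norm_I, Complex.norm_real,
        Real.norm_of_nonneg ht']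
      ring
    calc _ ≤ (t ^ d * ‖c‖) * (Real.exp (-a.re * t ^ 2) * ‖b‖) := by
          rw [norm_mul, h1]
          gcongr
          exact gaussianPhase_norm_le ht' (le_of_lt hw)
      _ = _ := by ring
  have hint : Integrable (fun t : ℝ => t ^ d * Real.exp (-a.re * t ^ 2) * (‖c‖ * ‖b‖))
      (volume.restrict (Set.Ioi (0 : ℝ))) :=
    (integrableOn_pow_mul_exp_neg_mul_sq ha d).mul_const _
  constructor
  · refine (hasDerivAt_integral_of_dominated_loc_of_deriv_le
      (F' := fun (w : ℂ) (t : ℝ) => (Complex.I * c * (t : ℂ) ^ d) *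
        (Complex.exp (Complex.I * w * c * (t : ℂ) ^ d - a * (t : ℂ) ^ 2) * b))
      (s := {w : ℂ | 0 < (w * c).im}) ?_ ?_ ?_ ?_ hbound hint ?_).2
    · exact (isOpen_lt continuous_const (by fun_prop)).mem_nhds hw
    · exact Eventually.of_forall fun w => Continuous.aestronglyMeasurable (by fun_prop)
    · refine Integrable.mono'
        (((integrable_exp_neg_mul_sq ha).integrableOn (s := Set.Ioi 0)).mul_const ‖b‖)
        (Continuous.aestronglyMeasurable (by fun_prop)) ?_
      filter_upwards [ae_restrict_mem measurableSet_Ioi] with t ht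
      exact gaussianPhase_norm_le (le_of_lt ht) (le_of_lt hw)
    · exact Continuous.aestronglyMeasurable (by fun_prop)
    · refine ae_of_all _ fun t w _ => ?_
      have h : HasDerivAt (fun w : ℂ => Complex.I * w * c * (t : ℂ) ^ d - a * (t : ℂ) ^ 2)
          (Complex.I * c * (t : ℂ) ^ d) w := by
        simpa using ((((hasDerivAt_id w).const_mul Complex.I).mul_const c).mul_const
          ((t : ℂ) ^ d)).sub_const (a * (t : ℂ) ^ 2)
      exact (h.cexp.mul_const b).congr_deriv (by ring)
  · exact norm_integral_le_of_norm_le hint (hbound.mono fun t ht => ht w hw)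

theorem phiTheta_regularity (d : ℕ) {θ : ℝ} (hθ : 0 < Real.cos (2 * θ)) :
    ∃ M : ℝ, ContinuousOn (phiTheta d θ) {w | 0 ≤ (w * Complex.exp (Complex.I * θ * d)).im} ∧
      (∀ w, 0 ≤ (w * Complex.exp (Complex.I * θ * d)).im → ‖phiTheta d θ w‖ ≤ M) ∧
      ∀ w, 0 < (w * Complex.exp (Complex.I * θ * d)).im →
        ∃ D, HasDerivAt (phiTheta d θ) D w ∧ ‖D‖ ≤ M := by
  have ha : 0 < ((1 / 2) * Complex.exp (2 * Complex.I * θ)).re := by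
    have h : (2 * Complex.I * θ : ℂ) = ((2 * θ : ℝ) : ℂ) * Complex.I := by push_cast; ring
    have h2 : ((1 / 2 : ℂ)) = ((1 / 2 : ℝ) : ℂ) := by push_cast; ring
    rw [h, h2, Complex.re_ofReal_mul, Complex.exp_ofReal_mul_I_re]
    positivity
  obtain ⟨M₁, hM₁⟩ : ∃ M, ∀ w, 0 ≤ (w * Complex.exp (Complex.I * θ * d)).im →
      ‖phiTheta d θ w‖ ≤ M :=
    ⟨_, fun w hw => (norm_mul_le _ _).trans
      (mul_le_mul_of_nonneg_left (norm_integral_gaussianPhase_le ha hw) (norm_nonneg _))⟩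
  obtain ⟨M₂, hM₂⟩ : ∃ M, ∀ w, 0 < (w * Complex.exp (Complex.I * θ * d)).im →
      ∃ D, HasDerivAt (phiTheta d θ) D w ∧ ‖D‖ ≤ M :=
    ⟨_, fun w hw => ⟨_, (hasDerivAt_integral_gaussianPhase ha hw).1.const_mul _,
      (norm_mul_le _ _).trans
        (mul_le_mul_of_nonneg_left (hasDerivAt_integral_gaussianPhase ha hw).2 (norm_nonneg _))⟩⟩
  refine ⟨max M₁ M₂, continuousOn_const.mul (continuousOn_integral_gaussianPhase _ _ d ha),
    fun w hw => (hM₁ w hw).trans (le_max_left _ _), fun w hw => ?_⟩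
  obtain ⟨D, hD, hDM⟩ := hM₂ w hw
  exact ⟨D, hD, hDM.trans (le_max_right _ _)⟩

theorem integrableOn_mul_exp_neg_mul {δ : ℝ} (hδ : 0 < δ) :
    IntegrableOn (fun s : ℝ => s * Real.exp (-δ * s)) (Set.Ioi 0) := by
  simpa using integrableOn_rpow_mul_exp_neg_mul_rpow (s := 1) (p := 1) (by norm_num)
    one_pos hδ

theorem tendsto_mul_exp_neg_mul_atTop {δ : ℝ} (hδ : 0 < δ) :
    Tendsto (fun s : ℝ => s * Real.exp (-δ * s)) atTop (𝓝 0) := by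
  simpa using tendsto_rpow_mul_exp_neg_mul_atTop_nhds_zero 1 δ hδ

theorem integral_deriv_ray_eq_zero {F : ℂ → ℂ} {p : ℂ} {U : Set ℂ} {C δ : ℝ} (hδ : 0 < δ)
    (hU : IsOpen U) (hF : DifferentiableOn ℂ F U)
    (hpU : ∀ s : ℝ, 0 < s → (s : ℂ) * p ∈ U)
    (hF_le : ∀ s : ℝ, 0 < s → ‖F (s * p)‖ ≤ C * Real.exp (-δ * s))
    (hint : IntegrableOn (fun s : ℝ => F (s * p) + s * (p * deriv F (s * p))) (Set.Ioi 0)) :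
    ∫ s in Set.Ioi (0 : ℝ), (F (s * p) + s * (p * deriv F (s * p))) = 0 := by
  have hle : ∀ s : ℝ, 0 < s → ‖(s : ℂ) * F (s * p)‖ ≤ C * (s * Real.exp (-δ * s)) := by
    intro s hs
    rw [norm_mul, Complex.norm_real, Real.norm_of_nonneg hs.le]
    calc _ ≤ s * (C * Real.exp (-δ * s)) := by gcongr; exact hF_le s hs
      _ = _ := by ring
  rw [integral_Ioi_of_hasDerivAt_of_tendsto (f := fun s : ℝ => (s : ℂ) * F (s * p)) (m := 0)
    ?_ ?_ hint ?_]
  · simp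
  · rw [← continuousWithinAt_Ioi_iff_Ici]
    have h : Tendsto (fun s : ℝ => C * (s * Real.exp (-δ * s))) (𝓝[>] 0) (𝓝 0) := by
      have hc : Continuous fun s : ℝ => C * (s * Real.exp (-δ * s)) := by fun_prop
      simpa using (hc.tendsto 0).mono_left nhdsWithin_le_nhds
    have h0 : Tendsto (fun s : ℝ => (s : ℂ) * F (s * p)) (𝓝[>] 0) (𝓝 0) :=
      squeeze_zero_norm' (eventually_mem_nhdsWithin.mono fun s hs => hle s hs) h
    simpa [ContinuousWithinAt] using h0
  · intro s hs
    have h1 : HasDerivAt (fun s : ℝ => (s : ℂ) * p) p s := by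
      simpa using (Complex.ofRealCLM.hasDerivAt (x := s)).mul_const p
    have h2 : HasDerivAt F (deriv F (s * p)) (s * p) :=
      (hF.differentiableAt (hU.mem_nhds (hpU s hs))).hasDerivAt
    have h3 : HasDerivAt (fun s : ℝ => F (s * p)) (deriv F (s * p) * p) s := h2.comp s h1
    refine ((Complex.ofRealCLM.hasDerivAt (x := s)).mul h3).congr_deriv ?_
    simp only [Complex.ofRealCLM_apply, Complex.ofReal_one]
    ring
  · have h : Tendsto (fun s : ℝ => C * (s * Real.exp (-δ * s))) atTop (𝓝 0) := by
      simpa using (tendsto_mul_exp_neg_mul_atTop hδ).const_mul C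
    exact squeeze_zero_norm' ((eventually_gt_atTop 0).mono fun s hs => hle s hs) h

theorem integral_ray_eq {F : ℂ → ℂ} {u v : ℂ} {S U : Set ℂ} {C δ : ℝ} (hδ : 0 < δ)
    (hU : IsOpen U) (hFS : ContinuousOn F S) (hFU : DifferentiableOn ℂ F U)
    (hS : ∀ τ ∈ Set.Icc (0 : ℝ) 1, ∀ s : ℝ, 0 < s → (s : ℂ) * (u + τ * (v - u)) ∈ S)
    (hUmem : ∀ τ ∈ Set.Ioo (0 : ℝ) 1, ∀ s : ℝ, 0 < s → (s : ℂ) * (u + τ * (v - u)) ∈ U)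
    (hF_le : ∀ τ ∈ Set.Icc (0 : ℝ) 1, ∀ s : ℝ, 0 < s →
      ‖F (s * (u + τ * (v - u)))‖ ≤ C * Real.exp (-δ * s))
    (hF'_le : ∀ τ ∈ Set.Ioo (0 : ℝ) 1, ∀ s : ℝ, 0 < s →
      ‖deriv F (s * (u + τ * (v - u)))‖ ≤ C * Real.exp (-δ * s)) :
    ∫ s in Set.Ioi (0 : ℝ), F (s * u) * u = ∫ s in Set.Ioi (0 : ℝ), F (s * v) * v := by
  have hexp : IntegrableOn (fun s : ℝ => Real.exp (-δ * s)) (Set.Ioi 0) :=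
    exp_neg_integrableOn_Ioi 0 hδ
  have hp_le : ∀ τ ∈ Set.Icc (0 : ℝ) 1, ‖u + τ * (v - u)‖ ≤ ‖u‖ + ‖v - u‖ := by
    intro τ hτ
    refine (norm_add_le _ _).trans (add_le_add_right ?_ _)
    rw [norm_mul, Complex.norm_real, Real.norm_of_nonneg hτ.1]
    exact mul_le_of_le_one_left (norm_nonneg _) hτ.2
  have hmeas : ∀ τ ∈ Set.Icc (0 : ℝ) 1,
      AEStronglyMeasurable (fun s : ℝ => F (s * (u + τ * (v - u))))
        (volume.restrict (Set.Ioi 0)) := fun τ hτ =>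
    ContinuousOn.aestronglyMeasurable
      (hFS.comp (by fun_prop) fun s hs => hS τ hτ s hs) measurableSet_Ioi
  have hmeas' : ∀ τ ∈ Set.Ioo (0 : ℝ) 1,
      AEStronglyMeasurable (fun s : ℝ => deriv F (s * (u + τ * (v - u))))
        (volume.restrict (Set.Ioi 0)) := fun τ hτ =>
    ContinuousOn.aestronglyMeasurable
      ((hFU.deriv hU).continuousOn.comp (by fun_prop) fun s hs => hUmem τ hτ s hs)
      measurableSet_Ioi
  have hG_le : ∀ τ ∈ Set.Icc (0 : ℝ) 1, ∀ s : ℝ, 0 < s →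
      ‖F (s * (u + τ * (v - u))) * (u + τ * (v - u))‖ ≤
        C * Real.exp (-δ * s) * (‖u‖ + ‖v - u‖) := by
    intro τ hτ s hs
    rw [norm_mul]
    exact mul_le_mul (hF_le τ hτ s hs) (hp_le τ hτ) (norm_nonneg _)
      ((norm_nonneg _).trans (hF_le τ hτ s hs))
  have hG_int : IntegrableOn (fun s : ℝ => C * Real.exp (-δ * s) * (‖u‖ + ‖v - u‖))
      (Set.Ioi 0) := (hexp.const_mul C).mul_const _
  have hcont : ContinuousOn (fun τ : ℝ => ∫ s in Set.Ioi (0 : ℝ),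
      F (s * (u + τ * (v - u))) * (u + τ * (v - u))) (Set.Icc 0 1) := by
    refine continuousOn_of_dominated (fun τ hτ => (hmeas τ hτ).mul_const _)
      (fun τ hτ => ?_) hG_int ?_
    · filter_upwards [ae_restrict_mem measurableSet_Ioi] with s hs using hG_le τ hτ s hs
    · filter_upwards [ae_restrict_mem measurableSet_Ioi] with s hs
      exact (hFS.comp (by fun_prop) fun τ hτ => hS τ hτ s hs).mul (by fun_prop)
  -- The integrand of the derivative is `v - u` times a total derivative along the ray.
  have hD_le : ∀ τ ∈ Set.Ioo (0 : ℝ) 1, ∀ s : ℝ, 0 < s →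
      ‖F (s * (u + τ * (v - u))) +
        s * ((u + τ * (v - u)) * deriv F (s * (u + τ * (v - u))))‖ ≤
      C * Real.exp (-δ * s) + (‖u‖ + ‖v - u‖) * C * (s * Real.exp (-δ * s)) := by
    intro τ hτ s hs
    have hτ' := Set.Ioo_subset_Icc_self hτ
    refine (norm_add_le _ _).trans (add_le_add (hF_le τ hτ' s hs) ?_)
    rw [norm_mul, norm_mul, Complex.norm_real, Real.norm_of_nonneg hs.le]
    calc _ ≤ s * ((‖u‖ + ‖v - u‖) * (C * Real.exp (-δ * s))) :=
          mul_le_mul_of_nonneg_left (mul_le_mul (hp_le τ hτ') (hF'_le τ hτ s hs)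
            (norm_nonneg _) (by positivity)) hs.le
      _ = _ := by ring
  have hD_int : IntegrableOn (fun s : ℝ => C * Real.exp (-δ * s) +
      (‖u‖ + ‖v - u‖) * C * (s * Real.exp (-δ * s))) (Set.Ioi 0) :=
    (hexp.const_mul C).add ((integrableOn_mul_exp_neg_mul hδ).const_mul _)
  have hD_meas : ∀ τ ∈ Set.Ioo (0 : ℝ) 1, AEStronglyMeasurable
      (fun s : ℝ => F (s * (u + τ * (v - u))) +
        s * ((u + τ * (v - u)) * deriv F (s * (u + τ * (v - u)))))
      (volume.restrict (Set.Ioi 0)) := fun τ hτ =>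
    (hmeas τ (Set.Ioo_subset_Icc_self hτ)).add
      (Complex.continuous_ofReal.aestronglyMeasurable.mul ((hmeas' τ hτ).const_mul _))
  have hderiv : ∀ τ ∈ Set.Ioo (0 : ℝ) 1, HasDerivAt (fun τ : ℝ => ∫ s in Set.Ioi (0 : ℝ),
      F (s * (u + τ * (v - u))) * (u + τ * (v - u))) 0 τ := by
    intro τ hτ
    have hτ' := Set.Ioo_subset_Icc_self hτ
    have hzero := integral_deriv_ray_eq_zero hδ hU hFU (hUmem τ hτ) (hF_le τ hτ')
      (Integrable.mono' hD_int (hD_meas τ hτ) (by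
        filter_upwards [ae_restrict_mem measurableSet_Ioi] with s hs using hD_le τ hτ s hs))
    have key := (hasDerivAt_integral_of_dominated_loc_of_deriv_le
      (μ := volume.restrict (Set.Ioi (0 : ℝ)))
      (F := fun (τ : ℝ) (s : ℝ) => F (s * (u + τ * (v - u))) * (u + τ * (v - u)))
      (F' := fun (τ : ℝ) (s : ℝ) => (v - u) * (F (s * (u + τ * (v - u))) +
        s * ((u + τ * (v - u)) * deriv F (s * (u + τ * (v - u))))))
      (s := Set.Ioo 0 1) (x₀ := τ)
      (bound := fun s : ℝ => ‖v - u‖ * (C * Real.exp (-δ * s) +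
        (‖u‖ + ‖v - u‖) * C * (s * Real.exp (-δ * s))))
      (Ioo_mem_nhds hτ.1 hτ.2) ?_ ?_ ((hD_meas τ hτ).const_mul _) ?_ (hD_int.const_mul _) ?_).2
    · rwa [integral_const_mul, hzero, mul_zero] at key
    · filter_upwards [Ioo_mem_nhds hτ.1 hτ.2] with σ hσ
      exact (hmeas σ (Set.Ioo_subset_Icc_self hσ)).mul_const _
    · refine Integrable.mono' hG_int ((hmeas τ hτ').mul_const _) ?_
      filter_upwards [ae_restrict_mem measurableSet_Ioi] with s hs using hG_le τ hτ' s hs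
    · filter_upwards [ae_restrict_mem measurableSet_Ioi] with s hs σ hσ
      rw [norm_mul]
      exact mul_le_mul_of_nonneg_left (hD_le σ hσ s hs) (norm_nonneg _)
    · filter_upwards [ae_restrict_mem measurableSet_Ioi] with s hs σ hσ
      have h1 : HasDerivAt (fun σ : ℝ => u + σ * (v - u)) (v - u) σ := by
        simpa using ((Complex.ofRealCLM.hasDerivAt (x := σ)).mul_const (v - u)).const_add u
      have h2 : HasDerivAt F (deriv F (s * (u + σ * (v - u)))) (s * (u + σ * (v - u))) :=
        (hFU.differentiableAt (hU.mem_nhds (hUmem σ hσ s hs))).hasDerivAt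
      have h3 : HasDerivAt (fun σ : ℝ => F (s * (u + σ * (v - u))))
          (deriv F (s * (u + σ * (v - u))) * (s * (v - u))) σ :=
        h2.comp σ (h1.const_mul (s : ℂ))
      exact (h3.mul h1).congr_deriv (by ring)
  have h01 := intervalIntegral.integral_eq_sub_of_hasDerivAt_of_le zero_le_one hcont hderiv
    intervalIntegrable_const
  rw [intervalIntegral.integral_zero] at h01
  simpa using (sub_eq_zero.mp h01.symm).symm

theorem im_segment_mul (u v c : ℂ) (s τ : ℝ) :
    ((s : ℂ) * (u + τ * (v - u)) * c).im =
      s * ((1 - τ) * (u * c).im + τ * (v * c).im) := by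
  simp
  ring

theorem eq_or_eq_neg_of_im_mul_eq_zero {u v c : ℂ} (hc : c ≠ 0) (huv : ‖u‖ = ‖v‖)
    (hu : (u * c).im = 0) (hv : (v * c).im = 0) : u = v ∨ u = -v := by
  have h : |(u * c).re| = |(v * c).re| := by
    rw [Complex.abs_re_eq_norm.mpr hu, Complex.abs_re_eq_norm.mpr hv, norm_mul, norm_mul, huv]
  rcases abs_eq_abs.mp h with h | h
  · exact Or.inl (mul_right_cancel₀ hc (Complex.ext h (by rw [hu, hv])))
  · refine Or.inr (mul_right_cancel₀ hc (Complex.ext ?_ ?_))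
    · rw [neg_mul, Complex.neg_re, h]
    · rw [neg_mul, Complex.neg_im, hu, hv, neg_zero]

theorem segment_im_pos {u v c : ℂ} (hu : 0 ≤ (u * c).im) (hv : 0 ≤ (v * c).im)
    (h : ¬((u * c).im = 0 ∧ (v * c).im = 0)) {τ : ℝ} (hτ : τ ∈ Set.Ioo (0 : ℝ) 1) {s : ℝ}
    (hs : 0 < s) : 0 < ((s : ℂ) * (u + τ * (v - u)) * c).im := by
  rw [im_segment_mul]
  have h1 : 0 < 1 - τ := by linarith [hτ.2]
  refine mul_pos hs ?_
  rcases hu.eq_or_lt with hu' | hu'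
  · have hv' : 0 < (v * c).im := lt_of_le_of_ne hv fun hv' => h ⟨hu'.symm, hv'.symm⟩
    have := mul_pos hτ.1 hv'
    have := mul_nonneg h1.le hu
    linarith
  · have := mul_pos h1 hu'
    have := mul_nonneg hτ.1.le hv
    linarith

theorem psi_ray_eq {g : ℂ → ℂ} (n : ℕ) {u v z c c' : ℂ} {M : ℝ}
    (hg : ContinuousOn g {w | 0 ≤ (w * c).im ∧ 0 ≤ (w * c').im})
    (hgM : ∀ w, 0 ≤ (w * c).im → 0 ≤ (w * c').im → ‖g w‖ ≤ M)
    (hg' : ∀ w, 0 < (w * c).im → 0 < (w * c').im → ∃ D, HasDerivAt g D w ∧ ‖D‖ ≤ M)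
    (huc : 0 ≤ (u * c).im) (hvc : 0 ≤ (v * c).im)
    (huc' : 0 ≤ (u * c').im) (hvc' : 0 ≤ (v * c').im)
    (hc : ¬((u * c).im = 0 ∧ (v * c).im = 0)) (hc' : ¬((u * c').im = 0 ∧ (v * c').im = 0))
    (hzu : (z * u).im < 0) (hzv : (z * v).im < 0) :
    ∫ s in Set.Ioi (0 : ℝ), (Complex.exp (-Complex.I * z * (s * u)) * g (s * u) ^ n) * u =
      ∫ s in Set.Ioi (0 : ℝ), (Complex.exp (-Complex.I * z * (s * v)) * g (s * v) ^ n) * v := by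
  obtain ⟨δ, hδ, hδu, hδv⟩ : ∃ δ > 0, δ ≤ -(z * u).im ∧ δ ≤ -(z * v).im :=
    ⟨min (-(z * u).im) (-(z * v).im), lt_min (by linarith) (by linarith), min_le_left _ _,
      min_le_right _ _⟩
  have hM : 0 ≤ M := (norm_nonneg _).trans (hgM 0 (by simp) (by simp))
  have hS : ∀ c : ℂ, 0 ≤ (u * c).im → 0 ≤ (v * c).im → ∀ τ ∈ Set.Icc (0 : ℝ) 1, ∀ s : ℝ,
      0 < s → 0 ≤ ((s : ℂ) * (u + τ * (v - u)) * c).im := by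
    intro c hu hv τ hτ s hs
    rw [im_segment_mul]
    have h1 : 0 ≤ 1 - τ := by linarith [hτ.2]
    have h2 := hτ.1
    positivity
  have hE : ∀ τ ∈ Set.Icc (0 : ℝ) 1, ∀ s : ℝ, 0 < s →
      ‖Complex.exp (-Complex.I * z * (s * (u + τ * (v - u))))‖ ≤ Real.exp (-δ * s) := by
    intro τ hτ s hs
    have h : (-Complex.I * z * (s * (u + τ * (v - u)))).re =
        ((s : ℂ) * (u + τ * (v - u)) * z).im := by
      rw [mul_assoc, neg_mul, Complex.neg_re, Complex.I_mul_re, neg_neg, mul_comm z]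
    rw [Complex.norm_exp, h, im_segment_mul, mul_comm u, mul_comm v]
    have h1 : 0 ≤ 1 - τ := by linarith [hτ.2]
    have h2 : (1 - τ) * (z * u).im + τ * (z * v).im ≤ -δ := by
      nlinarith [mul_le_mul_of_nonneg_left hδu h1, mul_le_mul_of_nonneg_left hδv hτ.1]
    rw [Real.exp_le_exp]
    nlinarith [mul_le_mul_of_nonneg_left h2 hs.le]
  have hderiv : ∀ w, 0 < (w * c).im → 0 < (w * c').im → ∃ D, ‖D‖ ≤ M ∧
      HasDerivAt (fun w => Complex.exp (-Complex.I * z * w) * g w ^ n)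
        (Complex.exp (-Complex.I * z * w) *
          (-Complex.I * z * g w ^ n + n * g w ^ (n - 1) * D)) w := by
    intro w hw hw'
    obtain ⟨D, hD, hDM⟩ := hg' w hw hw'
    refine ⟨D, hDM, ?_⟩
    have h1 : HasDerivAt (fun w => -Complex.I * z * w) (-Complex.I * z) w := by
      simpa using (hasDerivAt_id w).const_mul (-Complex.I * z)
    exact (h1.cexp.mul (hD.pow n)).congr_deriv (by simp only [Pi.pow_apply]; ring)
  refine integral_ray_eq (F := fun w => Complex.exp (-Complex.I * z * w) * g w ^ n)
    (S := {w | 0 ≤ (w * c).im ∧ 0 ≤ (w * c').im})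
    (U := {w | 0 < (w * c).im ∧ 0 < (w * c').im})
    (C := M ^ n + (‖z‖ * M ^ n + n * M ^ (n - 1) * M)) hδ ?_ ?_ ?_ ?_ ?_ ?_ ?_
  · have h : ∀ c : ℂ, IsOpen {w : ℂ | 0 < (w * c).im} := fun c =>
      isOpen_lt continuous_const (by fun_prop)
    exact (h c).inter (h c')
  · exact ContinuousOn.mul (by fun_prop) (hg.pow n)
  · intro w hw
    obtain ⟨D, -, hD⟩ := hderiv w hw.1 hw.2
    exact hD.differentiableAt.differentiableWithinAt
  · exact fun τ hτ s hs => ⟨hS c huc hvc τ hτ s hs, hS c' huc' hvc' τ hτ s hs⟩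
  · exact fun τ hτ s hs =>
      ⟨segment_im_pos huc hvc hc hτ hs, segment_im_pos huc' hvc' hc' hτ hs⟩
  · intro τ hτ s hs
    have h1 := hgM _ (hS c huc hvc τ hτ s hs) (hS c' huc' hvc' τ hτ s hs)
    rw [norm_mul, norm_pow, mul_comm]
    refine mul_le_mul ((pow_le_pow_left₀ (norm_nonneg _) h1 n).trans ?_) (hE τ hτ s hs)
      (norm_nonneg _) (by positivity)
    exact le_add_of_nonneg_right (by positivity)
  · intro τ hτ s hs
    have hτ' := Set.Ioo_subset_Icc_self hτ
    have h1 := hgM _ (hS c huc hvc τ hτ' s hs) (hS c' huc' hvc' τ hτ' s hs)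
    obtain ⟨D, hDM, hD⟩ := hderiv _ (segment_im_pos huc hvc hc hτ hs)
      (segment_im_pos huc' hvc' hc' hτ hs)
    rw [hD.deriv, norm_mul, mul_comm]
    refine mul_le_mul ?_ (hE τ hτ' s hs) (norm_nonneg _) (by positivity)
    refine (norm_add_le _ _).trans
      ((add_le_add ?_ ?_).trans (le_add_of_nonneg_left (by positivity)))
    · rw [norm_mul, norm_mul, norm_neg, Complex.norm_I, one_mul, norm_pow]
      gcongr
    · rw [norm_mul, norm_mul, Complex.norm_natCast, norm_pow]
      gcongr

theorem stmt_14 (d n : ℕ) (hd : 3 ≤ d) (hn : 1 ≤ n) (θ θ' : ℝ)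
    (hθ : 0 < Real.cos (2 * θ)) (hθ' : 0 < Real.cos (2 * θ'))
    (φ₁ φ₂ : ℝ) (hφ : |φ₁ - φ₂| < Real.pi)
    (h11 : 0 ≤ (Complex.exp (Complex.I * (φ₁ + θ * d))).im)
    (h12 : 0 ≤ (Complex.exp (Complex.I * (φ₁ + θ' * d))).im)
    (h21 : 0 ≤ (Complex.exp (Complex.I * (φ₂ + θ * d))).im)
    (h22 : 0 ≤ (Complex.exp (Complex.I * (φ₂ + θ' * d))).im)
    (z : ℂ)
    (hz1 : (z * Complex.exp (Complex.I * φ₁)).im < 0)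
    (hz2 : (z * Complex.exp (Complex.I * φ₂)).im < 0) :
    psiFn d n θ θ' φ₁ z = psiFn d n θ θ' φ₂ z := by
  set u := Complex.exp (Complex.I * φ₁) with hu
  set v := Complex.exp (Complex.I * φ₂) with hv
  have hrw : ∀ φ η : ℝ, Complex.exp (Complex.I * (φ + η * d)) =
      Complex.exp (Complex.I * φ) * Complex.exp (Complex.I * η * d) := by
    intro φ η
    rw [← Complex.exp_add]
    ring_nf
  rw [hrw] at h11 h12 h21 h22
  have hpsi : ∀ φ : ℝ, psiFn d n θ θ' φ z = ∫ s in Set.Ioi (0 : ℝ),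
      (Complex.exp (-Complex.I * z * (s * Complex.exp (Complex.I * φ))) *
        (phiTheta d θ (s * Complex.exp (Complex.I * φ)) -
          phiTheta d θ' (s * Complex.exp (Complex.I * φ))) ^ n) *
        Complex.exp (Complex.I * φ) := by
    intro φ
    refine integral_congr_ae (ae_of_all _ fun s => ?_)
    simp only [mul_comm (s : ℂ), mul_assoc]
  rw [hpsi, hpsi]
  by_cases huv : u = v
  · rw [← hu, ← hv, huv]
  have hnorm : ‖u‖ = ‖v‖ := by simp [hu, hv, mul_comm Complex.I, Complex.norm_exp_ofReal_mul_I]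
  have hne : ∀ c : ℂ, c ≠ 0 → ¬((u * c).im = 0 ∧ (v * c).im = 0) := by
    rintro c hc ⟨h1, h2⟩
    rcases eq_or_eq_neg_of_im_mul_eq_zero hc hnorm h1 h2 with h | h
    · exact huv h
    · rw [h, mul_neg, Complex.neg_im] at hz1
      linarith
  obtain ⟨M, hcont, hM, hderiv⟩ := phiTheta_regularity d hθ
  obtain ⟨M', hcont', hM', hderiv'⟩ := phiTheta_regularity d hθ'
  refine psi_ray_eq (g := fun w => phiTheta d θ w - phiTheta d θ' w) n (M := M + M')
    ((hcont.mono fun w hw => hw.1).sub (hcont'.mono fun w hw => hw.2))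
    (fun w hw hw' => (norm_sub_le _ _).trans (add_le_add (hM w hw) (hM' w hw')))
    (fun w hw hw' => ?_) h11 h21 h12 h22 (hne _ (Complex.exp_ne_zero _))
    (hne _ (Complex.exp_ne_zero _)) hz1 hz2
  obtain ⟨D, hD, hDM⟩ := hderiv w hw
  obtain ⟨D', hD', hDM'⟩ := hderiv' w hw'
  exact ⟨D - D', hD.sub hD', (norm_sub_le _ _).trans (add_le_add hDM hDM')⟩
end
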